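/- Let s and r be integers with 0 ≤ s ≤ r, let F be either ℝ or ℂ, and let n ≥ 2 be an integer. Suppose that either (1) s = 2^{t_1} + 1 and r = 2^{t_2} for some positive integers t_1, t_2, or (2) s = 2^{p_1} and r = 2^{p_2} + 1 for some positive integers p_1, p_2. Then n(s+r−1) − 1 ≤ TC_n(FH_{r,s}) ≤ n(s+r−1) + 1. -/

import Mathlib

open scoped unitInterval

noncomputable section

/-- Topology on the projectivization, as a quotient of the nonzero vectors. -/
instance projTop (K V : Type*) [DivisionRing K] [AddCommGroup V] [Module K V]
    [TopologicalSpace V] : TopologicalSpace (Projectivization K V) :=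
  inferInstanceAs (TopologicalSpace (Quotient (projectivizationSetoid K V)))

/-- The real Milnor manifold `ℝH_{r,s}`, as the subspace of `ℝPʳ × ℝPˢ` of pairs
`([x], [y])` with `x₀y₀ + ⋯ + x_sy_s = 0` (for `s ≤ r`). -/
def RealMilnor (r s : ℕ) :
    Set (Projectivization ℝ (Fin (r + 1) → ℝ) × Projectivization ℝ (Fin (s + 1) → ℝ)) :=
  {p | ∑ i : Fin (min (s + 1) (r + 1)),
      p.1.rep (Fin.castLE (min_le_right _ _) i) * p.2.rep (Fin.castLE (min_le_left _ _) i) = 0}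

/-- The complex Milnor manifold `ℂH_{r,s}`, as the subspace of `ℂPʳ × ℂPˢ` of pairs
`([z], [w])` with `z₀w̄₀ + ⋯ + z_sw̄_s = 0` (for `s ≤ r`). -/
def ComplexMilnor (r s : ℕ) :
    Set (Projectivization ℂ (Fin (r + 1) → ℂ) × Projectivization ℂ (Fin (s + 1) → ℂ)) :=
  {p | ∑ i : Fin (min (s + 1) (r + 1)),
      p.1.rep (Fin.castLE (min_le_right _ _) i) *
        (starRingEnd ℂ) (p.2.rep (Fin.castLE (min_le_left _ _) i)) = 0}

/-- The Lusternik–Schnirelmann category of `X`: the least number of open sets covering `X`,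
each of whose inclusion into `X` is null-homotopic. -/
def lsCat (X : Type*) [TopologicalSpace X] : ℕ :=
  sInf {k | 0 < k ∧ ∃ U : Fin k → Set X,
    (∀ i, IsOpen (U i)) ∧ (⋃ i, U i) = Set.univ ∧
    ∀ i, ∃ x₀ : X, ∃ H : C(U i × I, X),
      (∀ u : U i, H (u, 0) = (u : X)) ∧ (∀ u : U i, H (u, 1) = x₀)}

/-- The fibration `π_n : X^I → X^n`, evaluating a path at the times `i/(n-1)`,
`i = 0, …, n-1`. -/
def tcPi (X : Type*) [TopologicalSpace X] (n : ℕ) (γ : C(I, X)) : Fin n → X :=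
  fun i => γ (Set.projIcc (0 : ℝ) 1 zero_le_one ((i : ℝ) / ((n : ℝ) - 1)))

/-- The `n`-th higher (sequential) topological complexity of `X`: the least number of open
sets covering `X^n`, each admitting a continuous local section of `π_n : X^I → X^n`. -/
def higherTC (X : Type*) [TopologicalSpace X] (n : ℕ) : ℕ :=
  sInf {k | 0 < k ∧ ∃ U : Fin k → Set (Fin n → X),
    (∀ i, IsOpen (U i)) ∧ (⋃ i, U i) = Set.univ ∧
    ∀ i, ∃ sec : C(U i, C(I, X)), ∀ u : U i, tcPi X n (sec u) = (u : Fin n → X)}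

/-- The `n`-th higher equivariant topological complexity of a `G`-space `X`:
the least number of `G`-invariant open sets covering `X^n` (with the diagonal action),
each admitting a `G`-equivariant map to `X^I` whose composite with `π_n` is
`G`-homotopic to the inclusion. -/
def eqHigherTC (G : Type*) [Group G] (X : Type*) [TopologicalSpace X] [MulAction G X]
    (n : ℕ) : ℕ :=
  sInf {k | 0 < k ∧ ∃ U : Fin k → Set (Fin n → X),
    (∀ i, IsOpen (U i)) ∧ (⋃ i, U i) = Set.univ ∧
    (∀ i (g : G), ∀ v ∈ U i, g • v ∈ U i) ∧
    ∀ i, ∃ sec : C(U i, C(I, X)),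
      (∀ (g : G) (v : U i) (hgv : g • (v : Fin n → X) ∈ U i) (t : I),
        (sec ⟨g • (v : Fin n → X), hgv⟩) t = g • (sec v) t) ∧
      ∃ H : C(U i × I, Fin n → X),
        (∀ v : U i, H (v, 0) = tcPi X n (sec v)) ∧
        (∀ v : U i, H (v, 1) = (v : Fin n → X)) ∧
        (∀ (g : G) (v : U i) (hgv : g • (v : Fin n → X) ∈ U i) (t : I),
          H (⟨g • (v : Fin n → X), hgv⟩, t) = g • H (v, t))}

/-- `X` has covering dimension at most `m`: every finite open cover admits an open
refinement which still covers `X` and in which every point lies in at most `m + 1` sets. -/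
def HasCovDimLE (X : Type*) [TopologicalSpace X] (m : ℕ) : Prop :=
  ∀ 𝒰 : Set (Set X), 𝒰.Finite → (∀ U ∈ 𝒰, IsOpen U) → ⋃₀ 𝒰 = Set.univ →
    ∃ 𝒱 : Set (Set X), (∀ V ∈ 𝒱, IsOpen V) ∧ ⋃₀ 𝒱 = Set.univ ∧
      (∀ V ∈ 𝒱, ∃ U ∈ 𝒰, V ⊆ U) ∧
      ∀ x : X, {V ∈ 𝒱 | x ∈ V}.encard ≤ (m + 1 : ℕ)

/-- The covering dimension of `X`. -/
def covDim (X : Type*) [TopologicalSpace X] : ℕ :=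
  sInf {m | HasCovDimLE X m}

end

namespace MilnorBU

/-- Mod 2 chains of (augmented) ordered tuples of points. -/
abbrev Ch (V : Type*) := List V →₀ ZMod 2

noncomputable section

section basic
variable {V W : Type*}

def cone (b : V) : Ch V →ₗ[ZMod 2] Ch V := Finsupp.lmapDomain _ _ (List.cons b)

@[simp] theorem cone_single (b : V) (l : List V) (a : ZMod 2) :
    cone b (Finsupp.single l a) = Finsupp.single (b :: l) a := by
  simp [cone]

def bdL : List V → Ch V
  | [] => 0
  | v :: l => Finsupp.single l 1 + cone v (bdL l)

def lin {M : Type*} [AddCommGroup M] [Module (ZMod 2) M] (f : List V → M) :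
    Ch V →ₗ[ZMod 2] M := Finsupp.linearCombination (ZMod 2) f

@[simp] theorem lin_single {M : Type*} [AddCommGroup M] [Module (ZMod 2) M] (f : List V → M)
    (l : List V) : lin f (Finsupp.single l 1) = f l := by
  simp [lin]

theorem lin_ext {M : Type*} [AddCommGroup M] [Module (ZMod 2) M] {f g : Ch V →ₗ[ZMod 2] M}
    (h : ∀ l, f (Finsupp.single l 1) = g (Finsupp.single l 1)) (c : Ch V) : f c = g c := by
  have : f = g := by
    apply Finsupp.lhom_ext'
    intro l
    apply LinearMap.ext_ring
    simpa using h l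
  rw [this]

def bd : Ch V →ₗ[ZMod 2] Ch V := lin bdL

@[simp] theorem bd_single (l : List V) : bd (Finsupp.single l 1) = bdL l := by simp [bd]

theorem bd_cone (b : V) (c : Ch V) : bd (cone b c) = c + cone b (bd c) :=
  lin_ext (f := bd ∘ₗ cone b) (g := LinearMap.id + cone b ∘ₗ bd) (by intro l; simp [bdL]) c

theorem ch_add_self {M : Type*} [AddCommGroup M] [Module (ZMod 2) M] (c : M) : c + c = 0 := by
  have : (2 : ZMod 2) • c = c + c := two_smul _ c
  rw [← this, show (2 : ZMod 2) = 0 from rfl, zero_smul]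

theorem bd_bdL (l : List V) : bd (bdL l) = 0 := by
  induction l with
  | nil => simp [bdL]
  | cons v l ih => simp [bdL, bd_cone, ih, ch_add_self]

theorem bd_bd (c : Ch V) : bd (bd c) = 0 :=
  lin_ext (f := bd ∘ₗ bd) (g := 0) (by intro l; simp [bd_bdL]) c

def mp (f : V → W) : Ch V →ₗ[ZMod 2] Ch W := Finsupp.lmapDomain _ _ (List.map f)

@[simp] theorem mp_single (f : V → W) (l : List V) (a : ZMod 2) :
    mp f (Finsupp.single l a) = Finsupp.single (l.map f) a := by
  simp [mp]

theorem mp_cone (f : V → W) (b : V) (c : Ch V) : mp f (cone b c) = cone (f b) (mp f c) :=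
  lin_ext (f := mp f ∘ₗ cone b) (g := cone (f b) ∘ₗ mp f) (by intro l; simp) c

theorem bdL_map (f : V → W) (l : List V) : bdL (l.map f) = mp f (bdL l) := by
  induction l with
  | nil => simp [bdL]
  | cons v l ih => simp [bdL, ih, mp_cone]

theorem bd_mp (f : V → W) (c : Ch V) : bd (mp f c) = mp f (bd c) :=
  lin_ext (f := bd ∘ₗ mp f) (g := mp f ∘ₗ bd) (by intro l; simp [bdL_map]) c

theorem mp_mp {U : Type*} (f : V → W) (g : W → U) (c : Ch V) : mp g (mp f c) = mp (g ∘ f) c :=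
  lin_ext (f := mp g ∘ₗ mp f) (g := mp (g ∘ f)) (by intro l; simp) c

theorem mp_id (c : Ch V) : mp id c = c :=
  lin_ext (f := mp id) (g := LinearMap.id) (by intro l; simp) c

/-- chains supported in a set of tuples -/
abbrev sup (A : Set (List V)) : Submodule (ZMod 2) (Ch V) := Finsupp.supported _ _ A

theorem sup_map {A : Set (List V)} {M : Type*} [AddCommGroup M] [Module (ZMod 2) M]
    {N : Submodule (ZMod 2) M} (f : Ch V →ₗ[ZMod 2] M)
    (h : ∀ l ∈ A, f (Finsupp.single l 1) ∈ N) {c : Ch V} (hc : c ∈ sup A) : f c ∈ N := by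
  have : sup A ≤ N.comap f := by
    rw [sup, Finsupp.supported_eq_span_single, Submodule.span_le]
    rintro _ ⟨l, hl, rfl⟩
    exact h l hl
  exact this hc

theorem single_mem_sup {A : Set (List V)} {l : List V} (h : l ∈ A) :
    Finsupp.single l (1 : ZMod 2) ∈ sup A := Finsupp.single_mem_supported _ _ h

theorem cone_mem_sup {A B : Set (List V)} {b : V} (h : ∀ l ∈ A, b :: l ∈ B) {c : Ch V}
    (hc : c ∈ sup A) : cone b c ∈ sup B :=
  sup_map (cone b) (fun l hl => by rw [cone_single]; exact single_mem_sup (h l hl)) hc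

theorem mp_mem_sup {A : Set (List V)} {B : Set (List W)} {f : V → W}
    (h : ∀ l ∈ A, l.map f ∈ B) {c : Ch V} (hc : c ∈ sup A) : mp f c ∈ sup B :=
  sup_map (mp f) (fun l hl => by rw [mp_single]; exact single_mem_sup (h l hl)) hc

theorem bdL_mem (l : List V) :
    bdL l ∈ sup {l' : List V | l'.length + 1 = l.length ∧ ∀ v ∈ l', v ∈ l} := by
  induction l with
  | nil => simp [bdL]
  | cons v l ih =>
    refine Submodule.add_mem _ (single_mem_sup ⟨by simp, fun w hw => by simp [hw]⟩) ?_
    refine cone_mem_sup ?_ ih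
    rintro l' ⟨h1, h2⟩
    refine ⟨by simp [h1], ?_⟩
    intro w hw
    rcases List.mem_cons.1 hw with rfl | hw
    · simp
    · simp [h2 w hw]

end basic

section subdivision
variable {V : Type*} [NormedAddCommGroup V] [NormedSpace ℝ V]

def bary (l : List V) : V := (l.length : ℝ)⁻¹ • l.sum

def Sd (k : ℕ) : Ch V →ₗ[ZMod 2] Ch V :=
  Nat.rec LinearMap.id (fun _ S => lin (fun l => cone (bary l) (S (bdL l)))) k

theorem Sd_zero : (Sd 0 : Ch V →ₗ[ZMod 2] Ch V) = LinearMap.id := rfl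

theorem Sd_succ (k : ℕ) : (Sd (k + 1) : Ch V →ₗ[ZMod 2] Ch V) =
    lin (fun l => cone (bary l) (Sd k (bdL l))) := rfl

attribute [irreducible] Sd

theorem bd_Sd (k : ℕ) (c : Ch V) : bd (Sd (k + 1) c) = Sd k (bd c) := by
  induction k generalizing c with
  | zero =>
    refine lin_ext (f := bd ∘ₗ Sd 1) (g := Sd 0 ∘ₗ bd) ?_ c
    intro l
    simp [Sd_zero, Sd_succ, bd_cone, bd_bdL]
  | succ k ih =>
    refine lin_ext (f := (bd (V := V)) ∘ₗ (Sd (V := V) (k + 1 + 1)))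
      (g := (Sd (V := V) (k + 1)) ∘ₗ (bd (V := V))) ?_ c
    intro l
    have h := ih (bdL l)
    rw [bd_bdL, map_zero] at h
    rw [LinearMap.comp_apply, LinearMap.comp_apply, bd_single, Sd_succ, lin_single, bd_cone, h]
    simp

theorem bary_map (f : V →ₗ[ℝ] V) (l : List V) : bary (l.map f) = f (bary l) := by
  simp [bary, map_list_sum]

theorem Sd_mp (f : V →ₗ[ℝ] V) (k : ℕ) (c : Ch V) : Sd k (mp f c) = mp f (Sd k c) := by
  induction k generalizing c with
  | zero => simp [Sd_zero]
  | succ k ih =>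
    refine lin_ext (f := Sd (k + 1) ∘ₗ mp f) (g := mp f ∘ₗ Sd (k + 1)) ?_ c
    intro l
    simp only [LinearMap.comp_apply, mp_single, Sd_succ, lin_single, bary_map, bdL_map, ih, mp_cone]

theorem bary_mem {C : Set V} (hC : Convex ℝ C) {l : List V} (hl : l ≠ []) (h : ∀ v ∈ l, v ∈ C) :
    bary l ∈ C := by
  have h0 : (l.length : ℝ) ≠ 0 := by simp [hl]
  have key : bary l = ∑ i : Fin l.length, (l.length : ℝ)⁻¹ • l[i] := by
    rw [← Finset.smul_sum, bary]
    congr 1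
    exact (Fin.sum_univ_getElem l).symm
  rw [key]
  apply hC.sum_mem
  · intros; positivity
  · simp [h0]
  · intro i _
    exact h _ (List.getElem_mem _)

theorem dist_bary_le {l : List V} {δ : ℝ} (M : ℕ) (hM : l.length ≤ M + 1) (hδ : 0 ≤ δ)
    (h : ∀ v ∈ l, ∀ w ∈ l, dist v w ≤ δ) {v : V} (hv : v ∈ l) :
    dist v (bary l) ≤ (M / (M + 1) : ℝ) * δ := by
  have hl : l ≠ [] := List.ne_nil_of_mem hv
  have h0 : (l.length : ℝ) ≠ 0 := by simp [hl]
  have hpos : (0 : ℝ) < l.length := by positivity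
  obtain ⟨j, hj, rfl⟩ := List.getElem_of_mem hv
  have key : l[j] - bary l = (l.length : ℝ)⁻¹ • ∑ i : Fin l.length, (l[j] - l[i]) := by
    rw [bary, Finset.sum_sub_distrib, smul_sub]
    congr 1
    · simp [← Nat.cast_smul_eq_nsmul ℝ, smul_smul, h0]
    · congr 1
      exact (Fin.sum_univ_getElem l).symm
  rw [dist_eq_norm, key, norm_smul]
  have h1 : ‖∑ i : Fin l.length, (l[j] - l[i])‖ ≤ (l.length - 1) * δ := by
    rw [← Finset.sum_erase Finset.univ (a := (⟨j, hj⟩ : Fin l.length)) (by simp)]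
    refine (norm_sum_le_of_le _ (fun i _ => ?_)).trans (b := ∑ i ∈ Finset.univ.erase (⟨j, hj⟩ : Fin l.length), δ) ?_
    · rw [← dist_eq_norm]
      exact h _ hv _ (List.getElem_mem _)
    · rw [Finset.sum_const, Finset.card_erase_of_mem (Finset.mem_univ _), nsmul_eq_mul]
      simp only [Finset.card_univ, Fintype.card_fin]
      rw [Nat.cast_sub (by omega)]
      simp
  rw [norm_inv, Real.norm_natCast]
  calc (l.length : ℝ)⁻¹ * ‖∑ i : Fin l.length, (l[j] - l[i])‖
      ≤ (l.length : ℝ)⁻¹ * ((l.length - 1) * δ) := by gcongr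
    _ = ((l.length - 1) / l.length) * δ := by field_simp
    _ ≤ _ := by
      refine mul_le_mul_of_nonneg_right ?_ hδ
      rw [div_le_div_iff₀ hpos (by positivity)]
      have : (l.length : ℝ) ≤ M + 1 := by exact_mod_cast hM
      nlinarith

theorem Sd_mem (M k : ℕ) (hk : k ≤ M + 1) (δ : ℝ) (hδ : 0 ≤ δ) (l : List V) (hl : l.length = k)
    (h : ∀ v ∈ l, ∀ w ∈ l, dist v w ≤ δ) :
    Sd k (Finsupp.single l 1) ∈ sup {l' : List V | l'.length = k ∧
      (∀ v ∈ l', v ∈ convexHull ℝ {v | v ∈ l}) ∧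
      ∀ v ∈ l', ∀ w ∈ l', dist v w ≤ (M / (M + 1) : ℝ) * δ} := by
  induction k generalizing l with
  | zero =>
    obtain rfl := List.length_eq_zero_iff.1 hl
    rw [Sd_zero]
    exact single_mem_sup (by simp)
  | succ k ih =>
    have hne : l ≠ [] := by rintro rfl; simp at hl
    have hθ : (0 : ℝ) ≤ (M / (M + 1) : ℝ) * δ := by positivity
    rw [Sd_succ, lin_single]
    have hb : bary l ∈ convexHull ℝ {v | v ∈ l} :=
      bary_mem (convex_convexHull _ _) hne (fun v hv => subset_convexHull _ _ hv)
    have hball : convexHull ℝ {v | v ∈ l} ⊆ Metric.closedBall (bary l) ((M / (M + 1) : ℝ) * δ) := by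
      apply convexHull_min _ (convex_closedBall _ _)
      intro v hv
      exact dist_bary_le M (by omega) hδ h hv
    refine cone_mem_sup (A := {l' : List V | l'.length = k ∧
      (∀ v ∈ l', v ∈ convexHull ℝ {v | v ∈ l}) ∧
      ∀ v ∈ l', ∀ w ∈ l', dist v w ≤ (M / (M + 1) : ℝ) * δ}) ?_ ?_
    · rintro l' ⟨h1, h2, h3⟩
      refine ⟨by simp [h1], ?_, ?_⟩
      · intro v hv
        rcases List.mem_cons.1 hv with rfl | hv
        · exact hb
        · exact h2 v hv
      · intro v hv w hw
        rcases List.mem_cons.1 hv with rfl | hv <;> rcases List.mem_cons.1 hw with rfl | hw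
        · simpa using hθ
        · rw [dist_comm]; exact hball (h2 _ hw)
        · exact hball (h2 _ hv)
        · exact h3 _ hv _ hw
    · refine sup_map (Sd k) ?_ (bdL_mem l)
      rintro l' ⟨h1, h2⟩
      have := ih (by omega) l' (by omega) (fun v hv w hw => h v (h2 v hv) w (h2 w hw))
      refine Finsupp.supported_mono ?_ this
      rintro l'' ⟨a1, a2, a3⟩
      exact ⟨a1, fun v hv => convexHull_mono h2 (a2 v hv), a3⟩

/-- tuples of length `k` contained in a member of the family `𝒞` with diameter at most `δ` -/
def smallT (𝒞 : Set (Set V)) (k : ℕ) (δ : ℝ) : Set (List V) :=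
  {l | l.length = k ∧ (∃ C ∈ 𝒞, ∀ v ∈ l, v ∈ C) ∧ ∀ v ∈ l, ∀ w ∈ l, dist v w ≤ δ}

theorem Sd_iter_mem (𝒞 : Set (Set V)) (h𝒞 : ∀ C ∈ 𝒞, Convex ℝ C) (M k : ℕ) (hk : k ≤ M + 1)
    (δ : ℝ) (hδ : 0 ≤ δ) (N : ℕ) {c : Ch V} (hc : c ∈ sup (smallT 𝒞 k δ)) :
    (Sd k)^[N] c ∈ sup (smallT 𝒞 k ((M / (M + 1) : ℝ) ^ N * δ)) := by
  induction N with
  | zero => simpa using hc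
  | succ N ih =>
    rw [Function.iterate_succ_apply']
    refine sup_map (Sd k) ?_ ih
    rintro l ⟨h1, ⟨C, hC, h2⟩, h3⟩
    refine Finsupp.supported_mono ?_ (Sd_mem M k hk _ (by positivity) l h1 h3)
    rintro l' ⟨a1, a2, a3⟩
    refine ⟨a1, ⟨C, hC, fun v hv => convexHull_min h2 (h𝒞 C hC) (a2 v hv)⟩, ?_⟩
    intro v hv w hw
    have := a3 v hv w hw
    rw [pow_succ']
    linarith

end subdivision

section functional
variable {V : Type*}

def Phi : List (V → ZMod 2) → List V → ZMod 2
  | [], _ => 1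
  | _ :: _, [] => 0
  | _ :: _, [_] => 0
  | s :: ss, v :: w :: l => (s v + s w) * Phi ss (w :: l)

def Psi (s : V → ZMod 2) (ss : List (V → ZMod 2)) : List V → ZMod 2
  | [] => 0
  | v :: l => s v * Phi ss (v :: l)

theorem Psi_cone (s : V → ZMod 2) (ss : List (V → ZMod 2)) (v : V) (c : Ch V) :
    lin (Psi s ss) (cone v c) = s v * lin (Phi ss) (cone v c) := by
  refine lin_ext (f := lin (Psi s ss) ∘ₗ cone v) (g := s v • (lin (Phi ss) ∘ₗ cone v)) ?_ c
  intro l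
  simp [Psi]

theorem Phi_cocycle (ss : List (V → ZMod 2)) :
    (∀ l : List V, l.length = ss.length + 2 → lin (Phi ss) (bdL l) = 0) ∧
    ∀ s, ∀ l : List V, l.length = ss.length + 2 → lin (Psi s ss) (bdL l) = Phi (s :: ss) l := by
  have step : ∀ ss : List (V → ZMod 2),
      (∀ l : List V, l.length = ss.length + 2 → lin (Phi ss) (bdL l) = 0) →
      ∀ s, ∀ l : List V, l.length = ss.length + 2 → lin (Psi s ss) (bdL l) = Phi (s :: ss) l := by
    intro ss h s l hl
    match l, hl with
    | v :: w :: l, hl =>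
      have h1 := h (v :: w :: l) hl
      rw [bdL, map_add, lin_single] at h1
      rw [bdL, map_add, lin_single, Psi_cone, Psi, Phi]
      have h2 : lin (Phi ss) (cone v (bdL (w :: l))) = Phi ss (w :: l) := by
        have := ch_add_self (Phi ss (w :: l))
        linear_combination h1 - this
      rw [h2]
      ring
  suffices H : ∀ l : List V, l.length = ss.length + 2 → lin (Phi ss) (bdL l) = 0 from
    ⟨H, step ss H⟩
  induction ss with
  | nil =>
    intro l hl
    match l, hl with
    | [v, w], _ =>
      simp [bdL, Phi]
      rfl
  | cons s ss ih =>
    intro l hl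
    have h1 : lin (Phi (s :: ss)) (bdL l) = (lin (Psi s ss)) (bd (bdL l)) := by
      have : bdL l ∈ sup {l' : List V | l'.length = ss.length + 2} :=
        Finsupp.supported_mono (by rintro l' ⟨h, -⟩; simp at hl ⊢; omega) (bdL_mem l)
      have h2 := sup_map (N := ⊥) (lin (Phi (s :: ss)) - lin (Psi s ss) ∘ₗ bd) (by
        intro l' hl'
        simp [step ss ih s l' hl']) this
      simpa [sub_eq_zero] using h2
    rw [h1, bd_bdL, map_zero]

theorem Phi_zero (ss : List (V → ZMod 2)) (l : List V) (hl : l.length = ss.length + 1)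
    (h : ∃ s ∈ ss, ∀ v ∈ l, ∀ w ∈ l, s v = s w) : Phi ss l = 0 := by
  induction ss generalizing l with
  | nil => simp at h
  | cons s ss ih =>
    match l, hl with
    | v :: w :: l, hl =>
      rw [Phi]
      obtain ⟨s', hs', h⟩ := h
      rcases List.mem_cons.1 hs' with rfl | hs'
      · rw [h v (by simp) w (by simp), ch_add_self, zero_mul]
      · rw [ih (w :: l) (by simp at hl ⊢; omega), mul_zero]
        exact ⟨s', hs', fun a ha b hb => h a (by simp [ha]) b (by simp [hb])⟩

end functional

end

end MilnorBU

namespace MilnorBU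

noncomputable section

set_option linter.unusedSectionVars false

section family
open MvPolynomial

variable {V Λ : Type*} [Fintype Λ] [DecidableEq Λ]

/-- the chain `(1 + T) c` -/
def tw (T : V → V) : Ch V →ₗ[ZMod 2] Ch V := LinearMap.id + mp T

theorem tw_apply (T : V → V) (c : Ch V) : tw T c = c + mp T c := rfl

/-- boundary chain of the multi-hemisphere of multi-degree `κ` -/
def zed (T : Λ → V → V) (c : (Λ →₀ ℕ) → Ch V) (κ : Λ →₀ ℕ) : Ch V :=
  ∑ l ∈ κ.support, tw (T l) (c (κ - Finsupp.single l 1))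

def form (e : Finset Λ) : MvPolynomial Λ (ZMod 2) := ∑ l ∈ e, X l

theorem degree_sub {κ : Λ →₀ ℕ} {l : Λ} (h : l ∈ κ.support) :
    (κ - Finsupp.single l 1).degree + 1 = κ.degree := by
  have h1 : Finsupp.single l 1 ≤ κ := by
    rw [Finsupp.single_le_iff]
    have := Finsupp.mem_support_iff.1 h
    omega
  conv_rhs => rw [← tsub_add_cancel_of_le h1]
  rw [map_add]
  simp

theorem Phi_inv (G : Set V) (T : V → V) (ss : List (V → ZMod 2))
    (h : ∀ s ∈ ss, ∃ e : ZMod 2, ∀ v ∈ G, s (T v) = s v + e)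
    (l : List V) (hG : ∀ v ∈ l, v ∈ G) : Phi ss (l.map T) = Phi ss l := by
  induction ss generalizing l with
  | nil => simp [Phi]
  | cons s ss ih =>
    match l with
    | [] => simp [Phi]
    | [v] => simp [Phi]
    | v :: w :: l =>
      obtain ⟨e, he⟩ := h s (by simp)
      have := ih (fun s hs => h s (by simp [hs])) (w :: l) (fun a ha => hG a (by simp [ha]))
      rw [List.map_cons] at this
      rw [List.map_cons, List.map_cons, Phi, Phi, this, he v (hG v (by simp)), he w (hG w (by simp))]
      have := ch_add_self e
      linear_combination (Phi ss (w :: l)) * this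

theorem eval_family (G : Set V) (κm : Λ →₀ ℕ) (T : Λ → V → V) (c : (Λ →₀ ℕ) → Ch V)
    (hsup : ∀ κ, κ ≤ κm → c κ ∈ sup {l : List V | l.length = κ.degree + 1 ∧ ∀ v ∈ l, v ∈ G})
    (hbd : ∀ κ, κ ≤ κm → κ ≠ 0 → bd (c κ) = zed T c κ)
    (u : V) (h0 : c 0 = Finsupp.single [u] 1)
    (ss : List ((V → ZMod 2) × Finset Λ))
    (hss : ∀ p ∈ ss, ∀ l, ∀ v ∈ G, p.1 (T l v) = p.1 v + if l ∈ p.2 then 1 else 0)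
    (κ : Λ →₀ ℕ) (hκm : κ ≤ κm) (hκ : κ.degree = ss.length) :
    lin (Phi (ss.map Prod.fst)) (c κ) = coeff κ ((ss.map (fun p => form p.2)).prod) := by
  induction ss generalizing κ with
  | nil =>
    have : κ = 0 := (Finsupp.degree_eq_zero_iff κ).1 (by simpa using hκ)
    subst this
    simp [h0, Phi]
  | cons p ss ih =>
    have hne : κ ≠ 0 := by rintro rfl; simp at hκ
    have h1 : lin (Phi ((p :: ss).map Prod.fst)) (c κ)
        = lin (Psi p.1 (ss.map Prod.fst)) (bd (c κ)) := by
      have h2 := sup_map (N := ⊥) (lin (Phi ((p :: ss).map Prod.fst))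
          - lin (Psi p.1 (ss.map Prod.fst)) ∘ₗ bd) (by
        intro l' hl'
        have := (Phi_cocycle (ss.map Prod.fst)).2 p.1 l' (by
          have := hl'.1
          simp at this hκ ⊢; omega)
        simp [this]) (hsup κ hκm)
      simpa [sub_eq_zero] using h2
    rw [h1, hbd κ hκm hne, zed, map_sum]
    have h3 : ∀ l, ∀ d : Ch V, d ∈ sup {l : List V | l ≠ [] ∧ ∀ v ∈ l, v ∈ G} →
        lin (Psi p.1 (ss.map Prod.fst)) (tw (T l) d)
        = (if l ∈ p.2 then 1 else 0) * lin (Phi (ss.map Prod.fst)) d := by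
      intro l d hd
      have h2 := sup_map (N := ⊥) (lin (Psi p.1 (ss.map Prod.fst)) ∘ₗ tw (T l)
        - (if l ∈ p.2 then (1 : ZMod 2) else 0) • lin (Phi (ss.map Prod.fst))) (by
        intro l' hl'
        match l', hl' with
        | v :: l', hl' =>
        have hi := Phi_inv G (T l) (ss.map Prod.fst) (by
          intro s hs
          obtain ⟨q, hq, rfl⟩ := List.mem_map.1 hs
          exact ⟨_, hss q (by simp [hq]) l⟩) (v :: l') hl'.2
        rw [List.map_cons] at hi
        simp only [Submodule.mem_bot, LinearMap.sub_apply, LinearMap.comp_apply, tw_apply,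
          map_add, mp_single, lin_single, LinearMap.smul_apply, List.map_cons, Psi, hi]
        rw [hss p (by simp) l v (hl'.2 v (by simp))]
        have := ch_add_self (p.1 v)
        simp only [smul_eq_mul]
        linear_combination (Phi (ss.map Prod.fst) (v :: l')) * this) hd
      rw [Submodule.mem_bot, LinearMap.sub_apply, sub_eq_zero] at h2
      exact h2
    have h4 : coeff κ ((List.map (fun p => form p.2) (p :: ss)).prod)
        = ∑ l ∈ κ.support, (if l ∈ p.2 then 1 else 0) *
          coeff (κ - Finsupp.single l 1) ((ss.map (fun p => form p.2)).prod) := by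
      rw [List.map_cons, List.prod_cons, mul_comm, form, Finset.mul_sum, coeff_sum]
      simp_rw [coeff_mul_X']
      rw [← Finset.sum_filter]
      simp_rw [ite_mul, one_mul, zero_mul]
      rw [← Finset.sum_filter]
      congr 1
      ext l
      simp [and_comm]
    rw [h4]
    refine Finset.sum_congr rfl (fun l hl => ?_)
    have hd := degree_sub hl
    rw [h3, ih (fun q hq => hss q (by simp [hq]))]
    · exact tsub_le_self.trans hκm
    · simp at hκ; omega
    · refine Finsupp.supported_mono ?_ (hsup _ (tsub_le_self.trans hκm))
      rintro l' hl'
      refine ⟨?_, hl'.2⟩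
      rintro rfl
      simpa using hl'.1

/-- the cone construction of the multi-hemispheres -/
def cc (T : Λ → V → V) (u : (Λ →₀ ℕ) → V) : ℕ → (Λ →₀ ℕ) → Ch V
  | 0, κ => Finsupp.single [u κ] 1
  | j + 1, κ => cone (u κ) (zed T (cc T u j) κ)

theorem bd_zed (T : Λ → V → V) (c : (Λ →₀ ℕ) → Ch V)
    (hTT : ∀ l, T l ∘ T l = id) (hTc : ∀ l l', T l ∘ T l' = T l' ∘ T l)
    (κ : Λ →₀ ℕ)
    (hbd : ∀ l ∈ κ.support, bd (c (κ - Finsupp.single l 1)) = zed T c (κ - Finsupp.single l 1)) :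
    bd (zed T c κ) = 0 := by
  have bd_tw : ∀ l d, bd (tw (T l) d) = tw (T l) (bd d) := by
    intro l d; simp [tw_apply, bd_mp]
  have tw_tw : ∀ l d, tw (T l) (tw (T l) d) = 0 := by
    intro l d
    simp only [tw_apply, map_add, mp_mp, hTT, mp_id]
    have h1 := ch_add_self d
    have h2 := ch_add_self (mp (T l) d)
    calc _ = (d + d) + (mp (T l) d + mp (T l) d) := by abel
      _ = 0 := by rw [h1, h2, add_zero]
  have tw_comm : ∀ l l' d, tw (T l) (tw (T l') d) = tw (T l') (tw (T l) d) := by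
    intro l l' d
    simp only [tw_apply, map_add, mp_mp, hTc l l']
    abel
  have h1 : bd (zed T c κ) = ∑ p ∈ κ.support.sigma (fun l => (κ - Finsupp.single l 1).support),
      tw (T p.1) (tw (T p.2) (c (κ - Finsupp.single p.1 1 - Finsupp.single p.2 1))) := by
    rw [Finset.sum_sigma, zed, map_sum]
    refine Finset.sum_congr rfl (fun l hl => ?_)
    rw [bd_tw, hbd l hl, zed, map_sum]
  rw [h1]
  refine Finset.sum_involution (fun p _ => ⟨p.2, p.1⟩) ?_ ?_ ?_ ?_
  · rintro ⟨l, l'⟩ _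
    simp only
    rw [tw_comm l' l, tsub_right_comm, ch_add_self]
  · rintro ⟨l, l'⟩ _ hne heq
    simp only [Sigma.mk.injEq, heq_eq_eq] at heq
    obtain ⟨rfl, -⟩ := heq
    exact hne (tw_tw _ _)
  · rintro ⟨l, l'⟩ h
    simp only [Finset.mem_sigma, Finsupp.mem_support_iff, Finsupp.coe_tsub, Pi.sub_apply,
      Finsupp.single_apply] at h ⊢
    split_ifs at h ⊢ <;> grind
  · rintro ⟨l, l'⟩ _
    rfl

theorem bd_cc (T : Λ → V → V) (u : (Λ →₀ ℕ) → V)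
    (hTT : ∀ l, T l ∘ T l = id) (hTc : ∀ l l', T l ∘ T l' = T l' ∘ T l)
    (j : ℕ) (κ : Λ →₀ ℕ) (hκ : κ.degree = j + 1) :
    bd (cc T u (j + 1) κ) = zed T (cc T u j) κ := by
  have key : bd (zed T (cc T u j) κ) = 0 := by
    induction j generalizing κ with
    | zero =>
      rw [zed, map_sum]
      refine Finset.sum_eq_zero (fun l hl => ?_)
      simp [tw_apply, cc, bdL, ch_add_self]
    | succ j ih =>
      -- use cc at level j+1 and its boundary
      have bd_tw : ∀ l d, bd (tw (T l) d) = tw (T l) (bd d) := by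
        intro l d; simp [tw_apply, bd_mp]
      have hb : ∀ l ∈ κ.support, bd (cc T u (j + 1) (κ - Finsupp.single l 1))
          = zed T (cc T u j) (κ - Finsupp.single l 1) := by
        intro l hl
        have := degree_sub hl
        rw [cc, bd_cone, ih _ (by omega)]
        simp
      -- mixed family
      have := bd_zed T (fun κ' => if κ'.degree = j + 1 then cc T u (j + 1) κ' else cc T u j κ')
        hTT hTc κ (by
          intro l hl
          have h1 := degree_sub hl
          have h2 : (κ - Finsupp.single l 1).degree = j + 1 := by omega
          simp only [h2, if_true]
          rw [hb l hl, zed, zed]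
          refine Finset.sum_congr rfl (fun l' hl' => ?_)
          have h3 := degree_sub hl'
          rw [if_neg (by omega)])
      rw [zed] at this ⊢
      rw [← this]
      congr 1
      refine Finset.sum_congr rfl (fun l hl => ?_)
      have h1 := degree_sub hl
      rw [if_pos (by omega)]
  rw [cc, bd_cone, key]
  simp

end family

end

end MilnorBU

namespace MilnorBU

noncomputable section

set_option linter.unusedSectionVars false

section concrete
open MvPolynomial

variable {Λ : Type*} [Fintype Λ] [DecidableEq Λ]

/-- negate the `l`-th component -/
def Tn {E : Λ → Type*} [∀ l, AddCommGroup (E l)] (l : Λ) (z : ∀ l, E l) : ∀ l, E l :=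
  Function.update z l (-(z l))

theorem Tn_same {E : Λ → Type*} [∀ l, AddCommGroup (E l)] (l : Λ) (z : ∀ l, E l) :
    Tn l z l = - z l := by simp [Tn]

theorem Tn_ne {E : Λ → Type*} [∀ l, AddCommGroup (E l)] {l l' : Λ} (h : l' ≠ l) (z : ∀ l, E l) :
    Tn l z l' = z l' := by simp [Tn, h]

variable {m : Λ → ℕ}

def TL (l : Λ) : (∀ l, Fin (m l + 1) → ℝ) →ₗ[ℝ] (∀ l, Fin (m l + 1) → ℝ) where
  toFun := Tn l
  map_add' x y := by
    funext l'
    by_cases h : l' = l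
    · subst h; simp [Tn_same, add_comm]
    · simp [Tn_ne h]
  map_smul' a x := by
    funext l'
    by_cases h : l' = l
    · subst h; simp [Tn_same]
    · simp [Tn_ne h]

theorem Tn_Tn {E : Λ → Type*} [∀ l, AddCommGroup (E l)] (l : Λ) :
    (Tn l ∘ Tn l : (∀ l, E l) → ∀ l, E l) = id := by
  funext z l'
  by_cases h : l' = l
  · subst h; simp [Tn_same]
  · simp [Tn_ne h]

theorem Tn_comm {E : Λ → Type*} [∀ l, AddCommGroup (E l)] (l l' : Λ) :
    (Tn l ∘ Tn l' : (∀ l, E l) → ∀ l, E l) = Tn l' ∘ Tn l := by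
  by_cases hll : l = l'
  · subst hll; rfl
  funext z k
  by_cases h : k = l
  · subst h; simp [Tn_same, Tn_ne hll]
  · by_cases h' : k = l'
    · subst h'; simp [Tn_same, Tn_ne h]
    · simp [Tn_ne h, Tn_ne h']

/-- vertices -/
def uu (κ : Λ →₀ ℕ) : ∀ l, Fin (m l + 1) → ℝ := fun l i => if (i : ℕ) = κ l then 1 else 0

def isSign (η : ∀ l, Fin (m l + 1) → ℝ) : Prop := ∀ l i, η l i = 1 ∨ η l i = -1

def cell (η : ∀ l, Fin (m l + 1) → ℝ) : Set (∀ l, Fin (m l + 1) → ℝ) :=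
  {v | ∀ l, (∀ i, 0 ≤ η l i * v l i) ∧ ∑ i, η l i * v l i = 1}

def QQ (m : Λ → ℕ) : Set (∀ l, Fin (m l + 1) → ℝ) := {v | ∀ l, ∑ i, |v l i| = 1}

def cells (m : Λ → ℕ) : Set (Set (∀ l, Fin (m l + 1) → ℝ)) := {C | ∃ η, isSign η ∧ C = cell η}

theorem cell_sub {η : ∀ l, Fin (m l + 1) → ℝ} (h : isSign η) : cell η ⊆ QQ m := by
  intro v hv l
  rw [← (hv l).2]
  refine Finset.sum_congr rfl (fun i _ => ?_)
  have := (hv l).1 i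
  rcases h l i with h | h
  · rw [h] at this ⊢; rw [one_mul] at this ⊢; exact abs_of_nonneg this
  · rw [h] at this ⊢
    rw [abs_of_nonpos (by linarith)]; ring

theorem convex_cell (η : ∀ l, Fin (m l + 1) → ℝ) : Convex ℝ (cell η) := by
  intro x hx y hy a b ha hb hab l
  constructor
  · intro i
    have h1 := (hx l).1 i
    have h2 := (hy l).1 i
    have : η l i * (a • x + b • y) l i = a * (η l i * x l i) + b * (η l i * y l i) := by
      simp; ring
    rw [this]
    positivity
  · have : ∀ i, η l i * (a • x + b • y) l i = a * (η l i * x l i) + b * (η l i * y l i) := by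
      intro i; simp; ring
    simp_rw [this]
    rw [Finset.sum_add_distrib, ← Finset.mul_sum, ← Finset.mul_sum, (hx l).2, (hy l).2]
    linarith

theorem norm_le_of_QQ {v : ∀ l, Fin (m l + 1) → ℝ} (h : v ∈ QQ m) : ‖v‖ ≤ 1 := by
  rw [pi_norm_le_iff_of_nonneg zero_le_one]
  intro l
  rw [pi_norm_le_iff_of_nonneg zero_le_one]
  intro i
  rw [← h l]
  exact Finset.single_le_sum (f := fun i => |v l i|) (fun i _ => abs_nonneg _) (Finset.mem_univ i)

theorem compact_QQ (m : Λ → ℕ) : IsCompact (QQ m) := by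
  apply Metric.isCompact_of_isClosed_isBounded
  · have : QQ m = ⋂ l, {v : ∀ l, Fin (m l + 1) → ℝ | ∑ i, |v l i| = 1} := by
      ext v; simp [QQ]
    rw [this]
    apply isClosed_iInter
    intro l
    exact isClosed_eq (by fun_prop) continuous_const
  · apply (Metric.isBounded_closedBall (x := (0 : ∀ l, Fin (m l + 1) → ℝ)) (r := 1)).subset
    intro v hv
    simpa using norm_le_of_QQ hv

theorem ne_zero_of_QQ {v : ∀ l, Fin (m l + 1) → ℝ} (h : v ∈ QQ m) (l : Λ) : v l ≠ 0 := by
  intro h0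
  have := h l
  simp [h0] at this

def Inv (κ : Λ →₀ ℕ) (j : ℕ) : Set (List (∀ l, Fin (m l + 1) → ℝ)) :=
  {L | L.length = j + 1 ∧ ∃ η : ∀ l, Fin (m l + 1) → ℝ, isSign η ∧
    (∀ l (i : Fin (m l + 1)), (i : ℕ) = κ l → η l i = 1) ∧
    ∀ v ∈ L, v ∈ cell η ∧ ∀ l (i : Fin (m l + 1)), κ l < (i : ℕ) → v l i = 0}

theorem uu_mem {κ : Λ →₀ ℕ} (hκ : ∀ l, κ l ≤ m l) {η : ∀ l, Fin (m l + 1) → ℝ}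
    (hη : ∀ l (i : Fin (m l + 1)), (i : ℕ) = κ l → η l i = 1) : (uu κ : ∀ l, Fin (m l + 1) → ℝ) ∈ cell η ∧
      ∀ l (i : Fin (m l + 1)), κ l < (i : ℕ) → (uu κ : ∀ l, Fin (m l + 1) → ℝ) l i = 0 := by
  refine ⟨fun l => ⟨fun i => ?_, ?_⟩, ?_⟩
  · unfold uu
    split_ifs with h
    · rw [hη l i h]; norm_num
    · simp
  · rw [Finset.sum_eq_single (⟨κ l, Nat.lt_succ_of_le (hκ l)⟩ : Fin (m l + 1))]
    · simp [uu, hη l ⟨κ l, Nat.lt_succ_of_le (hκ l)⟩ rfl]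
    · intro i _ hi
      have : (i : ℕ) ≠ κ l := fun h => hi (Fin.ext h)
      simp [uu, this]
    · simp
  · intro l i h
    have : (i : ℕ) ≠ κ l := by omega
    simp [uu, this]

theorem cc_mem (j : ℕ) (κ : Λ →₀ ℕ) (hκ : ∀ l, κ l ≤ m l) (hj : κ.degree = j) :
    cc (Tn (E := fun l => Fin (m l + 1) → ℝ)) uu j κ ∈ sup (Inv κ j) := by
  induction j generalizing κ with
  | zero =>
    rw [cc]
    refine single_mem_sup ⟨by simp, fun _ _ => 1, fun _ _ => Or.inl rfl, fun _ _ _ => rfl, ?_⟩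
    intro v hv
    obtain rfl := List.mem_singleton.1 hv
    exact uu_mem hκ (fun _ _ _ => rfl)
  | succ j ih =>
    rw [cc]
    refine cone_mem_sup (A := {L | L.length = j + 1 ∧
      ∃ η : ∀ l, Fin (m l + 1) → ℝ, isSign η ∧
        (∀ l (i : Fin (m l + 1)), (i : ℕ) = κ l → η l i = 1) ∧
        ∀ v ∈ L, v ∈ cell η ∧ ∀ l (i : Fin (m l + 1)), κ l < (i : ℕ) → v l i = 0}) ?_ ?_
    · rintro L ⟨h1, η, h2, h3, h4⟩
      refine ⟨by simp [h1], η, h2, h3, ?_⟩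
      intro v hv
      rcases List.mem_cons.1 hv with rfl | hv
      · exact uu_mem hκ h3
      · exact h4 v hv
    · rw [zed]
      refine Submodule.sum_mem _ (fun l hl => ?_)
      have hd := degree_sub hl
      have hl0 := Finsupp.mem_support_iff.1 hl
      have hle : ∀ l', (κ - Finsupp.single l 1 : Λ →₀ ℕ) l' ≤ κ l' := fun l' => by simp
      have hself : (κ - Finsupp.single l 1 : Λ →₀ ℕ) l + 1 = κ l := by simp; omega
      have hne : ∀ l', l' ≠ l → (κ - Finsupp.single l 1 : Λ →₀ ℕ) l' = κ l' := fun l' h => by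
        simp [Finsupp.single_apply, h.symm]
      have hc := ih (κ - Finsupp.single l 1) (fun l' => (hle l').trans (hκ l')) (by omega)
      -- general modification of the sign pattern
      have fixη : ∀ η : ∀ l, Fin (m l + 1) → ℝ, isSign η →
          (∀ l' (i : Fin (m l' + 1)), l' ≠ l → (i : ℕ) = κ l' → η l' i = 1) →
          ∀ L : List (∀ l, Fin (m l + 1) → ℝ), L.length = j + 1 →
          (∀ v ∈ L, v ∈ cell η ∧ ∀ l' (i : Fin (m l' + 1)), (κ - Finsupp.single l 1 : Λ →₀ ℕ) l' < (i : ℕ) → v l' i = 0) →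
          L ∈ {L | L.length = j + 1 ∧
            ∃ η : ∀ l, Fin (m l + 1) → ℝ, isSign η ∧
              (∀ l (i : Fin (m l + 1)), (i : ℕ) = κ l → η l i = 1) ∧
              ∀ v ∈ L, v ∈ cell η ∧ ∀ l (i : Fin (m l + 1)), κ l < (i : ℕ) → v l i = 0} := by
        intro η h2 h3 L hL h4
        refine ⟨hL, fun l' i => if l' = l ∧ (i : ℕ) = κ l' then 1 else η l' i, ?_, ?_, ?_⟩
        · intro l' i
          dsimp only
          split_ifs
          · exact Or.inl rfl
          · exact h2 l' i
        · intro l' i hi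
          dsimp only
          split_ifs with h
          · rfl
          · by_cases hll : l' = l
            · exact absurd ⟨hll, hi⟩ h
            · exact h3 l' i hll hi
        · intro v hv
          obtain ⟨ha, hb⟩ := h4 v hv
          have heq : ∀ l' (i : Fin (m l' + 1)), (if l' = l ∧ (i : ℕ) = κ l' then 1 else η l' i) * v l' i
              = η l' i * v l' i := by
            intro l' i
            split_ifs with h
            · obtain ⟨rfl, h⟩ := h
              rw [hb l' i (by omega)]; simp
            · rfl
          refine ⟨fun l' => ⟨fun i => ?_, ?_⟩, fun l' i hi => hb l' i ((hle l').trans_lt hi)⟩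
          · rw [heq]; exact (ha l').1 i
          · simp_rw [heq]; exact (ha l').2
      rw [tw_apply]
      refine Submodule.add_mem _ ?_ ?_
      · refine Finsupp.supported_mono ?_ hc
        rintro L ⟨h1, η, h2, h3, h4⟩
        exact fixη η h2 (fun l' i hll hi => h3 l' i (by rw [hne l' hll]; exact hi)) L h1 h4
      · refine mp_mem_sup ?_ hc
        rintro L ⟨h1, η, h2, h3, h4⟩
        refine fixη (Tn l η) ?_ ?_ _ (by simp [h1]) ?_
        · intro l' i
          by_cases h : l' = l
          · subst h
            rw [Tn_same]
            rcases h2 l' i with h | h <;> simp [h]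
          · rw [Tn_ne h]; exact h2 l' i
        · intro l' i hll hi
          rw [Tn_ne hll]
          exact h3 l' i (by rw [hne l' hll]; exact hi)
        · intro v hv
          obtain ⟨w, hw, rfl⟩ := List.mem_map.1 hv
          obtain ⟨ha, hb⟩ := h4 w hw
          have heq : ∀ l' i, Tn l η l' i * Tn l w l' i = η l' i * w l' i := by
            intro l' i
            by_cases h : l' = l
            · subst h; simp [Tn_same]
            · simp [Tn_ne h]
          refine ⟨fun l' => ⟨fun i => ?_, ?_⟩, fun l' i hi => ?_⟩
          · rw [heq]; exact (ha l').1 i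
          · simp_rw [heq]; exact (ha l').2
          · by_cases h : l' = l
            · subst h; simp [Tn_same, hb l' i hi]
            · simp [Tn_ne h, hb l' i hi]

end concrete

end

end MilnorBU

namespace MilnorBU

noncomputable section

set_option linter.unusedSectionVars false

section iter
variable {V : Type*} [NormedAddCommGroup V] [NormedSpace ℝ V]

theorem bd_iter (k N : ℕ) (c : Ch V) : bd ((Sd (k + 1))^[N] c) = (Sd k)^[N] (bd c) := by
  induction N with
  | zero => rfl
  | succ N ih => rw [Function.iterate_succ_apply', Function.iterate_succ_apply', bd_Sd, ih]

theorem iter_mp (f : V →ₗ[ℝ] V) (k N : ℕ) (c : Ch V) :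
    (Sd k)^[N] (mp f c) = mp f ((Sd k)^[N] c) := by
  induction N with
  | zero => rfl
  | succ N ih => rw [Function.iterate_succ_apply', Function.iterate_succ_apply', ih, Sd_mp]

theorem iter_single (u : V) (N : ℕ) :
    (Sd 1)^[N] (Finsupp.single [u] 1 : Ch V) = Finsupp.single [u] 1 := by
  induction N with
  | zero => rfl
  | succ N ih =>
    rw [Function.iterate_succ_apply', ih, Sd_succ, Sd_zero]
    simp [bdL, bary]

end iter

section real
open MvPolynomial

variable {Λ : Type*} [Fintype Λ] [DecidableEq Λ]

open Classical in
def chi {k : ℕ} (x : Fin k → ℝ) : ZMod 2 := if toLex x < 0 then 1 else 0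

theorem chi_neg {k : ℕ} {x : Fin k → ℝ} (hx : x ≠ 0) : chi (-x) = chi x + 1 := by
  unfold chi
  have h1 : toLex (-x) = - toLex x := rfl
  have h2 : toLex x ≠ 0 := hx
  rw [h1, neg_lt_zero]
  have h3 : (toLex x < 0 ∧ ¬ (0 < toLex x)) ∨ (0 < toLex x ∧ ¬ (toLex x < 0)) := by
    rcases lt_or_gt_of_ne h2 with h | h
    · exact Or.inl ⟨h, h.not_gt⟩
    · exact Or.inr ⟨h, h.not_gt⟩
  rcases h3 with ⟨h, h'⟩ | ⟨h, h'⟩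
  · rw [if_pos h, if_neg h']; decide
  · rw [if_pos h, if_neg h']; decide

variable {m : Λ → ℕ}

def dflt (e : Finset Λ) (z : ∀ l, Fin (m l + 1) → ℝ) : ZMod 2 := ∑ l ∈ e, chi (z l)

theorem dflt_Tn (e : Finset Λ) (z : ∀ l, Fin (m l + 1) → ℝ) (hz : ∀ l, z l ≠ 0) (l : Λ) :
    dflt e (Tn l z) = dflt e z + if l ∈ e then 1 else 0 := by
  unfold dflt
  have : ∀ l', chi (Tn l z l') = chi (z l') + if l' = l then 1 else 0 := by
    intro l'
    by_cases h : l' = l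
    · subst h; rw [Tn_same, chi_neg (hz _)]; simp
    · rw [Tn_ne h]; simp [h]
  simp_rw [this, Finset.sum_add_distrib]
  simp

def sgn (e : Finset Λ) (h : (∀ l, Fin (m l + 1) → ℝ) → ℝ) (z : ∀ l, Fin (m l + 1) → ℝ) : ZMod 2 :=
  if h z = 0 then dflt e z else if h z < 0 then 1 else 0

theorem sgn_Tn (e : Finset Λ) (h : (∀ l, Fin (m l + 1) → ℝ) → ℝ)
    (z : ∀ l, Fin (m l + 1) → ℝ) (hz : ∀ l, z l ≠ 0) (l : Λ)
    (hh : h (Tn l z) = if l ∈ e then - h z else h z) :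
    sgn e h (Tn l z) = sgn e h z + if l ∈ e then 1 else 0 := by
  unfold sgn
  rw [hh, dflt_Tn e z hz l]
  split_ifs with h1 h2 h3 h4 h5 h6 <;> first | rfl | decide | skip
  all_goals first | (exfalso; simp_all; done) | skip
  all_goals first | (exfalso; rcases lt_or_gt_of_ne h2 <;> linarith)

theorem sgn_const (e : Finset Λ) (h : (∀ l, Fin (m l + 1) → ℝ) → ℝ)
    (z : ∀ l, Fin (m l + 1) → ℝ) (h0 : h z ≠ 0) (hc : ContinuousAt h z) :
    ∀ᶠ w in nhds z, sgn e h w = sgn e h z := by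
  rcases lt_or_gt_of_ne h0 with h1 | h1
  · filter_upwards [hc.eventually (gt_mem_nhds h1)] with w hw
    simp [sgn, hw.ne, hw, h0, h1]
  · filter_upwards [hc.eventually (lt_mem_nhds h1)] with w hw
    simp [sgn, hw.ne', hw.not_gt, h0, h1.not_gt]

theorem form_homog (e : Finset Λ) : (form e).IsHomogeneous 1 :=
  IsHomogeneous.sum _ _ _ (fun l _ => isHomogeneous_X _ l)

theorem BU_real {ι : Type*} [Fintype ι] (m : Λ → ℕ) (ε : ι → Finset Λ)
    (h : ι → (∀ l, Fin (m l + 1) → ℝ) → ℝ)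
    (hh : ∀ i l z, (∀ l, z l ≠ 0) → h i (Tn l z) = if l ∈ ε i then - h i z else h i z)
    (hc : coeff (Finsupp.equivFunOnFinite.symm m) (∏ i, form (ε i)) = 1) :
    ∃ z ∈ QQ m, ∀ i, h i z = 0 ∨ ¬ ContinuousAt (h i) z := by
  classical
  by_contra hcon
  push Not at hcon
  set κm : Λ →₀ ℕ := Finsupp.equivFunOnFinite.symm m with hκm
  have hκm' : ∀ l, κm l = m l := fun l => rfl
  -- degree
  have hdeg : κm.degree = Fintype.card ι := by
    by_contra hne
    have h1 : (∏ i, form (ε i)).IsHomogeneous (∑ i : ι, 1) :=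
      IsHomogeneous.prod _ _ _ (fun i _ => form_homog (ε i))
    rw [h1.coeff_eq_zero (by simpa using hne)] at hc
    exact zero_ne_one hc
  -- Lebesgue number
  have hloc : ∀ z : QQ m, ∃ U : Set (∀ l, Fin (m l + 1) → ℝ), IsOpen U ∧ (z : ∀ l, Fin (m l + 1) → ℝ) ∈ U ∧
      ∃ i, ∀ w ∈ U, sgn (ε i) (h i) w = sgn (ε i) (h i) z := by
    rintro ⟨z, hz⟩
    obtain ⟨i, h0, h1⟩ := hcon z hz
    obtain ⟨U, hU1, hU2, hU3⟩ := eventually_nhds_iff.1 (sgn_const (ε i) (h i) z h0 h1)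
    exact ⟨U, hU2, hU3, i, hU1⟩
  choose U hUo hUz hUi using hloc
  obtain ⟨δ, hδ, hleb⟩ := lebesgue_number_lemma_of_metric (compact_QQ m) hUo (by
    intro z hz
    exact Set.mem_iUnion.2 ⟨⟨z, hz⟩, hUz ⟨z, hz⟩⟩)
  set M := κm.degree with hM
  obtain ⟨N, hN⟩ : ∃ N : ℕ, ((M / (M + 1) : ℝ)) ^ N < δ / 2 :=
    exists_pow_lt_of_lt_one (by positivity) (by rw [div_lt_one (by positivity)]; linarith)
  let T : Λ → (∀ l, Fin (m l + 1) → ℝ) → (∀ l, Fin (m l + 1) → ℝ) := Tn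
  let c : (Λ →₀ ℕ) → Ch (∀ l, Fin (m l + 1) → ℝ) := fun κ =>
    (Sd (κ.degree + 1))^[N] (cc T uu κ.degree κ)
  have hle : ∀ κ, κ ≤ κm → ∀ l, κ l ≤ m l := fun κ hκ l => hκ l
  have hsm : ∀ κ, κ ≤ κm → c κ ∈ sup (smallT (cells m) (κ.degree + 1)
      ((M / (M + 1) : ℝ) ^ N * 2)) := by
    intro κ hκ
    refine Sd_iter_mem _ ?_ M _ ?_ 2 (by norm_num) N ?_
    · rintro _ ⟨η, _, rfl⟩
      exact convex_cell η
    · have := Finsupp.degree_mono hκ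
      omega
    · refine Finsupp.supported_mono ?_ (cc_mem κ.degree κ (hle κ hκ) rfl)
      rintro L ⟨h1, η, h2, h3, h4⟩
      refine ⟨h1, ⟨cell η, ⟨η, h2, rfl⟩, fun v hv => (h4 v hv).1⟩, ?_⟩
      intro v hv w hw
      have a1 := norm_le_of_QQ (cell_sub h2 (h4 v hv).1)
      have a2 := norm_le_of_QQ (cell_sub h2 (h4 w hw).1)
      rw [dist_eq_norm]
      linarith [norm_sub_le v w]
  have hev := eval_family (QQ m) κm T c (by
      intro κ hκ
      refine Finsupp.supported_mono ?_ (hsm κ hκ)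
      rintro L ⟨h1, ⟨_, ⟨η, hη, rfl⟩, h2⟩, h3⟩
      exact ⟨h1, fun v hv => cell_sub hη (h2 v hv)⟩) (by
      intro κ hκ hne
      obtain ⟨j, hj⟩ : ∃ j, κ.degree = j + 1 :=
        Nat.exists_eq_succ_of_ne_zero (fun h => hne ((Finsupp.degree_eq_zero_iff κ).1 h))
      change bd ((Sd (κ.degree + 1))^[N] (cc T uu κ.degree κ)) = _
      rw [hj, bd_iter, bd_cc T uu Tn_Tn Tn_comm j κ hj, zed, zed]
      rw [← Module.End.pow_apply, map_sum]
      refine Finset.sum_congr rfl (fun l hl => ?_)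
      have h1 := degree_sub hl
      have h2 : (κ - Finsupp.single l 1).degree = j := by omega
      have h3 : c (κ - Finsupp.single l 1) = (Sd (j + 1) ^ N) (cc T uu j (κ - Finsupp.single l 1)) := by
        simp only [c, h2, Module.End.pow_apply]
      rw [h3, tw_apply, tw_apply, map_add]
      congr 1
      rw [Module.End.pow_apply, Module.End.pow_apply]
      exact iter_mp (TL l) _ _ _) (uu 0) (by
      change (Sd ((0 : Λ →₀ ℕ).degree + 1))^[N] (cc T uu (0 : Λ →₀ ℕ).degree 0) = _
      rw [map_zero, cc, zero_add, iter_single])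
    ((Finset.univ : Finset ι).toList.map (fun i => (sgn (ε i) (h i), ε i))) (by
      intro p hp l v hv
      obtain ⟨i, -, rfl⟩ := List.mem_map.1 hp
      have hv' := ne_zero_of_QQ hv
      exact sgn_Tn (ε i) (h i) v hv' l (hh i l v hv')) κm le_rfl (by simp; exact hdeg)
  rw [List.map_map, List.map_map] at hev
  have h1 : (List.map ((fun p : ((∀ l, Fin (m l + 1) → ℝ) → ZMod 2) × Finset Λ => form p.2) ∘
      fun i => (sgn (ε i) (h i), ε i)) (Finset.univ : Finset ι).toList).prod = ∏ i, form (ε i) :=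
    Finset.prod_map_toList _ _
  rw [h1, hc] at hev
  have h2 := sup_map (N := ⊥) (lin (Phi (List.map (Prod.fst ∘ fun i => (sgn (ε i) (h i), ε i))
      (Finset.univ : Finset ι).toList))) (by
    rintro L ⟨a1, ⟨_, ⟨η, hη, rfl⟩, a2⟩, a3⟩
    rw [lin_single, Submodule.mem_bot]
    apply Phi_zero
    · rw [a1]; simp [← hdeg, hM]
    · match L, a1 with
      | v :: L, a1 =>
      obtain ⟨z, hz⟩ := hleb v (cell_sub hη (a2 v (by simp)))
      obtain ⟨i, hi⟩ := hUi z
      refine ⟨sgn (ε i) (h i), List.mem_map.2 ⟨i, by simp, rfl⟩, ?_⟩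
      have : ∀ w ∈ v :: L, sgn (ε i) (h i) w = sgn (ε i) (h i) z := by
        intro w hw
        apply hi
        apply hz
        rw [Metric.mem_ball]
        have := a3 w hw v (by simp)
        linarith
      intro w hw w' hw'
      rw [this w hw, this w' hw']) (hsm κm le_rfl)
  rw [Submodule.mem_bot, hev] at h2
  exact one_ne_zero h2

end real

end

end MilnorBU

namespace MilnorBU

noncomputable section

set_option linter.unusedSectionVars false

section bup
open MvPolynomial

/-- A Borsuk-Ulam property for products of spheres over `K`. -/
def BUProp (K : Type) [RCLike K] : Prop :=
  ∀ (Λ : Type) [Fintype Λ] [DecidableEq Λ] (m : Λ → ℕ),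
    ∃ Q : Set (∀ l, Fin (m l + 1) → K), IsCompact Q ∧ (∀ z ∈ Q, ∀ l, z l ≠ 0) ∧
    ∀ (ι : Type) [Fintype ι] (ε : ι → Finset Λ) (h : ι → (∀ l, Fin (m l + 1) → K) → K),
      (∀ i l z, (∀ l, z l ≠ 0) → h i (Tn l z) = if l ∈ ε i then - h i z else h i z) →
      coeff (Finsupp.equivFunOnFinite.symm m) (∏ i, form (ε i)) = 1 →
      ∃ z ∈ Q, ∀ i, h i z = 0 ∨ ¬ ContinuousAt (h i) z

theorem BUProp_real : BUProp ℝ := fun _ _ _ m =>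
  ⟨QQ m, compact_QQ m, fun _ hz l => ne_zero_of_QQ hz l, fun _ _ ε h hh hc => BU_real m ε h hh hc⟩

variable {Λ : Type} [Fintype Λ] [DecidableEq Λ]

def toC (m : Λ → ℕ) (z : ∀ l, Fin ((2 * m l + 1) + 1) → ℝ) : ∀ l, Fin (m l + 1) → ℂ :=
  fun l i => ⟨z l ⟨2 * i, by omega⟩, z l ⟨2 * i + 1, by omega⟩⟩

theorem toC_cont (m : Λ → ℕ) : Continuous (toC m) := by
  refine continuous_pi (fun l => continuous_pi (fun i => ?_))
  have : ∀ z : ∀ l, Fin ((2 * m l + 1) + 1) → ℝ, toC m z l i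
      = (z l ⟨2 * i, by omega⟩ : ℂ) + (z l ⟨2 * i + 1, by omega⟩ : ℂ) * Complex.I := by
    intro z
    exact Complex.mk_eq_add_mul_I _ _
  simp_rw [this]
  fun_prop

theorem toC_Tn (m : Λ → ℕ) (l : Λ) (z : ∀ l, Fin ((2 * m l + 1) + 1) → ℝ) :
    toC m (Tn l z) = Tn l (toC m z) := by
  funext l' i
  by_cases h : l' = l
  · subst h; rw [Tn_same]; simp [toC, Tn_same, Complex.ext_iff]
  · rw [Tn_ne h]; simp [toC, Tn_ne h]

theorem toC_ne (m : Λ → ℕ) (z : ∀ l, Fin ((2 * m l + 1) + 1) → ℝ) (l : Λ) (hz : z l ≠ 0) :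
    toC m z l ≠ 0 := by
  intro h
  apply hz
  funext k
  have h1 := congrFun h ⟨k / 2, by omega⟩
  simp only [toC, Pi.zero_apply, Complex.ext_iff, Complex.zero_re, Complex.zero_im] at h1
  have h2 : (k : ℕ) = 2 * (k / 2) ∨ (k : ℕ) = 2 * (k / 2) + 1 := by omega
  rcases h2 with h2 | h2
  · exact (congrArg (z l) (Fin.ext h2)).trans h1.1
  · exact (congrArg (z l) (Fin.ext h2)).trans h1.2

theorem coeff_double (m : Λ → ℕ) (P : MvPolynomial Λ (ZMod 2))
    (h : coeff (Finsupp.equivFunOnFinite.symm m) P = 1) :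
    coeff (Finsupp.equivFunOnFinite.symm (fun l => 2 * m l + 1)) (P * (P * ∏ l, X l)) = 1 := by
  have h1 : (∏ l, X l : MvPolynomial Λ (ZMod 2)) = monomial (Finsupp.equivFunOnFinite.symm (fun _ => 1)) 1 := by
    rw [monomial_eq]
    simp [Finsupp.prod_fintype]
  have h2 : Finsupp.equivFunOnFinite.symm (fun l => 2 * m l + 1)
    = 2 • Finsupp.equivFunOnFinite.symm m + Finsupp.equivFunOnFinite.symm (fun _ => 1) := by
    ext l; simp
  have : Fact (Nat.Prime 2) := ⟨Nat.prime_two⟩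
  rw [← mul_assoc, h1, h2, coeff_mul_monomial, mul_one, ← sq, ← expand_zmod, coeff_expand_smul _ two_ne_zero, h]

theorem BUProp_complex : BUProp ℂ := by
  intro Λ _ _ m
  refine ⟨toC m '' QQ (fun l => 2 * m l + 1), (compact_QQ _).image (toC_cont m), ?_, ?_⟩
  · rintro _ ⟨z, hz, rfl⟩ l
    exact toC_ne m z l (ne_zero_of_QQ hz l)
  · intro ι _ ε h hh hc
    obtain ⟨z, hz, H⟩ := BU_real (ι := ι ⊕ (ι ⊕ Λ)) (fun l => 2 * m l + 1)
      (Sum.elim ε (Sum.elim ε (fun l => {l})))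
      (Sum.elim (fun i z => (h i (toC m z)).re)
        (Sum.elim (fun i z => (h i (toC m z)).im) (fun _ _ => 0))) (by
        rintro (i | i | i) l z hz
        · change (h i (toC m (Tn l z))).re
            = if l ∈ ε i then -(h i (toC m z)).re else (h i (toC m z)).re
          rw [toC_Tn, hh i l _ (fun l => toC_ne m z l (hz l))]
          split_ifs <;> simp
        · change (h i (toC m (Tn l z))).im
            = if l ∈ ε i then -(h i (toC m z)).im else (h i (toC m z)).im
          rw [toC_Tn, hh i l _ (fun l => toC_ne m z l (hz l))]
          split_ifs <;> simp
        · simp) (by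
        rw [Fintype.prod_sum_type, Fintype.prod_sum_type]
        simp only [Sum.elim_inl, Sum.elim_inr]
        have := coeff_double m _ hc
        simpa [form] using this)
    refine ⟨_, ⟨z, hz, rfl⟩, fun i => ?_⟩
    by_cases hcont : ContinuousAt (h i) (toC m z)
    · left
      have hc2 : ContinuousAt (fun z => h i (toC m z)) z :=
        ContinuousAt.comp hcont (toC_cont m).continuousAt
      have h1 := H (Sum.inl i)
      have h2 := H (Sum.inr (Sum.inl i))
      simp only [Sum.elim_inl, Sum.elim_inr] at h1 h2
      have c1 : ContinuousAt (fun z => (h i (toC m z)).re) z :=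
        Complex.continuous_re.continuousAt.comp hc2
      have c2 : ContinuousAt (fun z => (h i (toC m z)).im) z :=
        Complex.continuous_im.continuousAt.comp hc2
      exact Complex.ext (h1.resolve_right (not_not.2 c1)) (h2.resolve_right (not_not.2 c2))
    · exact Or.inr hcont

end bup

end

end MilnorBU

namespace MilnorBU

noncomputable section

set_option linter.unusedSectionVars false

section algebra
open MvPolynomial

theorem absorb {R : Type*} [CommRing R] {z x : R} (h : z * x = 0) (y : R) (k : ℕ) :
    z * (x + y) ^ k = z * y ^ k := by
  induction k with
  | zero => simp
  | succ k ih =>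
    rw [pow_succ, ← mul_assoc, ih, pow_succ]
    linear_combination y ^ k * h

theorem absorb_prod {R ι : Type*} [CommRing R] {z : R} (f g : ι → R) (s : Finset ι)
    (h : ∀ i, z * f i = z * g i) : z * ∏ i ∈ s, f i = z * ∏ i ∈ s, g i := by
  classical
  induction s using Finset.induction_on with
  | empty => simp
  | insert a s ha ih =>
    rw [Finset.prod_insert ha, Finset.prod_insert ha]
    linear_combination (∏ i ∈ s, f i) * h a + g a * ih

theorem ring_main {R : Type*} [CommRing R] [CharP R 2] (k p q N M : ℕ) (hN : N = 2 ^ p)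
    (hM : M = 2 ^ q)
    (A B : Fin (k + 2) → R) (hA : ∀ i, A i ^ (N + 1) = 0) (hB : ∀ i, B i ^ (M + 1 + 1) = 0) :
    (∏ i, (A i + B i)) *
      ((A 0 + A 1) ^ (2 * N - 1) * (B 0 + B 1) ^ (2 * M - 1) *
        ∏ i : Fin k, ((A 0 + A i.succ.succ) ^ N * (B 0 + B i.succ.succ) ^ M)) * (A 0 * B 1)
      = ∏ i, (A i ^ N * B i ^ (M + 1)) := by
  have hN0 : 1 ≤ N := hN ▸ Nat.one_le_two_pow
  have hM0 : 1 ≤ M := hM ▸ Nat.one_le_two_pow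
  obtain ⟨N', hN'⟩ : ∃ N', N = N' + 1 := ⟨N - 1, by omega⟩
  obtain ⟨M', hM'⟩ : ∃ M', M = M' + 1 := ⟨M - 1, by omega⟩
  have : Fact (Nat.Prime 2) := ⟨Nat.prime_two⟩
  have fA : (A 0 + A 1) ^ N = A 0 ^ N + A 1 ^ N := by rw [hN]; exact add_pow_char_pow _ _ _ _
  have fB : (B 0 + B 1) ^ M = B 0 ^ M + B 1 ^ M := by rw [hM]; exact add_pow_char_pow _ _ _ _
  have e1 : (A 0 + A 1) ^ (2 * N - 1) * A 0 = A 0 ^ N * A 1 ^ N := by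
    have h1 : 2 * N - 1 = N + N' := by omega
    rw [h1, pow_add, fA]
    have h2 : (A 0 * A 1 ^ N) * (A 1 + A 0) ^ N' = (A 0 * A 1 ^ N) * A 0 ^ N' :=
      absorb (by have := hA 1; rw [pow_succ] at this; linear_combination A 0 * this) _ _
    have h3 := hA 0
    rw [pow_succ] at h3
    have h4 : A 0 ^ N = A 0 ^ N' * A 0 := by rw [hN', pow_succ]
    rw [add_comm (A 1) (A 0)] at h2
    linear_combination h2 + (A 0 + A 1) ^ N' * h3 - A 1 ^ N * h4
  have e2 : (B 0 + B 1) ^ (2 * M - 1) * (B 1 * (B 0 * B 1)) = B 0 ^ (M + 1) * B 1 ^ (M + 1) := by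
    have h1 : 2 * M - 1 = M + M' := by omega
    rw [h1, pow_add, fB]
    have h0 := hB 0
    rw [pow_succ] at h0
    have h0' := hB 1
    rw [pow_succ, pow_succ] at h0'
    have h2 : (B 0 ^ (M + 1)) * (B 0 + B 1) ^ M' = (B 0 ^ (M + 1)) * B 1 ^ M' :=
      absorb h0 _ _
    have h4 : B 1 ^ (M + 1) = B 1 ^ M' * B 1 * B 1 := by rw [hM', pow_succ, pow_succ]
    have h5 : B 0 ^ (M + 1) = B 0 ^ M * B 0 := pow_succ _ _
    rw [h4]
    rw [h5] at h2 ⊢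
    linear_combination B 1 * B 1 * h2 + (B 0 + B 1) ^ M' * B 0 * h0'
  have hA0 := hA 0
  have hA1 := hA 1
  have hB0 := hB 0
  have hB1 := hB 1
  rw [pow_succ] at hA0 hA1 hB0 hB1
  have e3 : (A 0 + B 0) * (A 1 + B 1) * ((A 0 + A 1) ^ (2 * N - 1) * (B 0 + B 1) ^ (2 * M - 1))
      * (A 0 * B 1) = A 0 ^ N * A 1 ^ N * (B 0 ^ (M + 1) * B 1 ^ (M + 1)) := by
    rw [← e2]
    have : (A 0 + B 0) * (A 1 + B 1) * ((A 0 + A 1) ^ (2 * N - 1) * (B 0 + B 1) ^ (2 * M - 1))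
      * (A 0 * B 1) = (A 0 + B 0) * (A 1 + B 1) * ((A 0 + A 1) ^ (2 * N - 1) * A 0)
        * ((B 0 + B 1) ^ (2 * M - 1) * B 1) := by ring
    rw [this, e1]
    linear_combination ((B 0 + B 1) ^ (2 * M - 1) * B 1) * ((A 1 + B 1) * A 1 ^ N * hA0
      + B 0 * A 0 ^ N * hA1)
  set top := A 0 ^ N * A 1 ^ N * (B 0 ^ (M + 1) * B 1 ^ (M + 1)) with htop
  have t1 : top * A 0 = 0 := by
    rw [htop]; linear_combination A 1 ^ N * (B 0 ^ (M + 1) * B 1 ^ (M + 1)) * hA0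
  have t2 : top * B 0 = 0 := by
    rw [htop]; linear_combination A 0 ^ N * A 1 ^ N * B 1 ^ (M + 1) * hB0
  have hS := absorb_prod (z := top)
    (fun i : Fin k => (A i.succ.succ + B i.succ.succ) *
      ((A 0 + A i.succ.succ) ^ N * (B 0 + B i.succ.succ) ^ M))
    (fun i : Fin k => A i.succ.succ ^ N * B i.succ.succ ^ (M + 1)) Finset.univ (by
      intro i
      have h1 := absorb t1 (A i.succ.succ) N
      have h2 := absorb t2 (B i.succ.succ) M
      have h3 := hA i.succ.succ
      rw [pow_succ] at h3
      rw [pow_succ]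
      linear_combination (A i.succ.succ + B i.succ.succ) *
        ((B 0 + B i.succ.succ) ^ M * h1 + A i.succ.succ ^ N * h2)
        + top * B i.succ.succ ^ M * h3)
  rw [Finset.prod_mul_distrib] at hS
  rw [Fin.prod_univ_succ, Fin.prod_univ_succ, Fin.prod_univ_succ (n := k + 1), Fin.prod_univ_succ (n := k)]
  rw [Fin.succ_zero_eq_one]
  have hrhs : A 0 ^ N * B 0 ^ (M + 1) * (A 1 ^ N * B 1 ^ (M + 1) *
    ∏ i : Fin k, A i.succ.succ ^ N * B i.succ.succ ^ (M + 1))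
    = top * ∏ i : Fin k, A i.succ.succ ^ N * B i.succ.succ ^ (M + 1) := by rw [htop]; ring
  rw [hrhs, ← hS, ← e3]
  ring

/-- multiplicities of the zero-divisors -/
def mult (k : ℕ) (c : Bool) (E : Bool → ℕ) (l : Fin (k + 2) × Bool) : ℕ :=
  if l.1 = 0 then 0 else
    if l.2 = c then (if l.1 = 1 then 2 * E c - 1 else E c)
    else (if l.1 = 1 then 2 * E (!c) - 3 else E (!c) - 1)

abbrev ZZ (k : ℕ) (c : Bool) (E : Bool → ℕ) : Type := Σ l : Fin (k + 2) × Bool, Fin (mult k c E l)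

theorem ZZ_ne {k : ℕ} {c : Bool} {E : Bool → ℕ} (z : ZZ k c E) : z.1.1 ≠ 0 := by
  intro h
  have := z.2.2
  simp [mult, h] at this

theorem ss_ne (k : ℕ) (i : Fin k) : i.succ.succ ≠ (1 : Fin (k + 2)) := by
  rw [← Fin.succ_zero_eq_one]
  exact fun h => Fin.succ_ne_zero i (Fin.succ_injective _ h)

theorem card_ZZ (k : ℕ) (c : Bool) (E : Bool → ℕ) (h1 : 2 ≤ E true) (h2 : 2 ≤ E false) :
    Fintype.card (ZZ k c E) + 2 = (k + 2) * (E false + E true - 1) := by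
  rw [Fintype.card_sigma]
  simp only [Fintype.card_fin]
  rw [Fintype.sum_prod_type, Fin.sum_univ_succ, Fin.sum_univ_succ]
  have e : ∀ i : Fin k, ∑ y, mult k c E (i.succ.succ, y) = E false + E true - 1 := by
    intro i
    cases c <;> simp [mult, ss_ne] <;> omega
  rw [Finset.sum_congr rfl (fun i _ => e i)]
  obtain ⟨w, hw⟩ : ∃ w, E false + E true = w + 1 := ⟨E false + E true - 1, by omega⟩
  cases c <;> simp [mult, hw] <;> ring_nf <;> omega

theorem coeff_of_quot {Λ : Type*} [Fintype Λ] [DecidableEq Λ] (m : Λ → ℕ)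
    (P : MvPolynomial Λ (ZMod 2))
    (h : Ideal.Quotient.mk (Ideal.span (Set.range (fun l => (X l : MvPolynomial Λ (ZMod 2)) ^ (m l + 1)))) P
      = Ideal.Quotient.mk _ (∏ l, X l ^ m l)) :
    coeff (Finsupp.equivFunOnFinite.symm m) P = 1 := by
  rw [Ideal.Quotient.eq] at h
  have h1 : ∀ p ∈ Ideal.span (Set.range (fun l => (X l : MvPolynomial Λ (ZMod 2)) ^ (m l + 1))),
      coeff (Finsupp.equivFunOnFinite.symm m) p = 0 := by
    intro p hp
    have hr : Set.range (fun l => (X l : MvPolynomial Λ (ZMod 2)) ^ (m l + 1))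
        = (fun s => monomial s (1 : ZMod 2)) '' Set.range (fun l => Finsupp.single l (m l + 1)) := by
      rw [← Set.range_comp]
      congr 1
      funext l
      simp [X_pow_eq_monomial]
    rw [hr, mem_ideal_span_monomial_image] at hp
    by_contra hne
    obtain ⟨_, ⟨l, rfl⟩, hl⟩ := hp _ (mem_support_iff.2 hne)
    have := hl l
    simp at this
  have h2 := h1 _ h
  rw [coeff_sub, sub_eq_zero] at h2
  rw [h2]
  have h3 : (∏ l, X l ^ m l : MvPolynomial Λ (ZMod 2)) = monomial (Finsupp.equivFunOnFinite.symm m) 1 := by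
    rw [monomial_eq]
    simp [Finsupp.prod_fintype]
  rw [h3, coeff_monomial, if_pos rfl]

theorem form_pair {Λ : Type*} [Fintype Λ] [DecidableEq Λ] {a b : Λ} (h : a ≠ b) :
    form {a, b} = X a + X b := by
  rw [form, Finset.sum_pair h]

theorem coeff_main (k p q : ℕ) (c : Bool) (E : Bool → ℕ) (h1 : E c = 2 ^ p)
    (h2 : E (!c) = 2 ^ q + 1) :
    coeff (Finsupp.equivFunOnFinite.symm (fun l : Fin (k + 2) × Bool => E l.2))
      ((∏ i : Fin (k + 2), form {(i, true), (i, false)}) *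
        ((∏ z : ZZ k c E, form {(0, z.1.2), z.1}) *
          (form {(0, c)} * form {(1, !c)}))) = 1 := by
  apply coeff_of_quot
  set II := Ideal.span (Set.range (fun l : Fin (k + 2) × Bool =>
    (X l : MvPolynomial (Fin (k + 2) × Bool) (ZMod 2)) ^ (E l.2 + 1))) with hI
  by_cases htriv : II = ⊤
  · rw [Ideal.Quotient.eq, htriv]; trivial
  have : Nontrivial (MvPolynomial (Fin (k + 2) × Bool) (ZMod 2) ⧸ II) := Ideal.Quotient.nontrivial_iff.2 htriv
  have : CharP (MvPolynomial (Fin (k + 2) × Bool) (ZMod 2) ⧸ II) 2 :=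
    charP_of_injective_algebraMap (algebraMap (ZMod 2) _).injective 2
  have key := ring_main k p q (E c) (2 ^ q) h1 rfl
    (fun i => Ideal.Quotient.mk II (X (i, c))) (fun i => Ideal.Quotient.mk II (X (i, !c))) (by
      intro i
      rw [← map_pow, Ideal.Quotient.eq_zero_iff_mem]
      exact Ideal.subset_span ⟨(i, c), rfl⟩) (by
      intro i
      rw [← h2, ← map_pow, Ideal.Quotient.eq_zero_iff_mem]
      exact Ideal.subset_span ⟨(i, !c), rfl⟩)
  simp only [← map_pow, ← map_add, ← map_mul, ← map_prod] at key
  have hR : (∏ l : Fin (k + 2) × Bool, X l ^ E l.2 : MvPolynomial (Fin (k + 2) × Bool) (ZMod 2))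
      = ∏ i : Fin (k + 2), X (i, c) ^ E c * X (i, !c) ^ (2 ^ q + 1) := by
    rw [Fintype.prod_prod_type]
    refine Finset.prod_congr rfl (fun i _ => ?_)
    rw [← h2]
    cases c <;> simp [mul_comm]
  rw [hR, ← key]
  congr 1
  have hβ : (∏ i : Fin (k + 2), form {(i, true), (i, false)} : MvPolynomial (Fin (k + 2) × Bool) (ZMod 2))
      = ∏ i : Fin (k + 2), (X (i, c) + X (i, !c)) := by
    refine Finset.prod_congr rfl (fun i _ => ?_)
    rw [form_pair (by simp)]
    cases c <;> simp [add_comm]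
  have hZ : (∏ z : ZZ k c E, form {(0, z.1.2), z.1} : MvPolynomial (Fin (k + 2) × Bool) (ZMod 2))
      = ∏ z : ZZ k c E, (X (0, z.1.2) + X z.1) := by
    refine Finset.prod_congr rfl (fun z _ => form_pair ?_)
    intro h
    exact ZZ_ne z (congrArg Prod.fst h).symm
  rw [hβ, hZ, Fintype.prod_sigma, Fintype.prod_prod_type]
  simp only [Finset.prod_const, Finset.card_univ, Fintype.card_fin]
  rw [Fin.prod_univ_succ (n := k + 1) (f := fun i => ∏ y, (X (0, y) + X (i, y)) ^ mult k c E (i, y)),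
    Fin.prod_univ_succ (n := k) ]
  have e0 : ∏ y, (X (0, y) + X (0, y) : MvPolynomial (Fin (k + 2) × Bool) (ZMod 2)) ^ mult k c E (0, y) = 1 := by
    simp [mult]
  have e1 : ∏ y, (X (0, y) + X ((0 : Fin (k + 1)).succ, y) : MvPolynomial (Fin (k + 2) × Bool) (ZMod 2)) ^
      mult k c E ((0 : Fin (k + 1)).succ, y) =
      (X (0, c) + X (1, c)) ^ (2 * E c - 1) * (X (0, !c) + X (1, !c)) ^ (2 * 2 ^ q - 1) := by
    have : 2 * 2 ^ q - 1 = 2 * E (!c) - 3 := by rw [h2]; rfl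
    rw [this]
    cases c <;> simp [mult, mul_comm]
  have e2 : ∀ i : Fin k, ∏ y, (X (0, y) + X (i.succ.succ, y) : MvPolynomial (Fin (k + 2) × Bool) (ZMod 2)) ^
      mult k c E (i.succ.succ, y) =
      (X (0, c) + X (i.succ.succ, c)) ^ (E c) * (X (0, !c) + X (i.succ.succ, !c)) ^ (2 ^ q) := by
    intro i
    have : 2 ^ q = E (!c) - 1 := by rw [h2]; rfl
    rw [this]
    cases c <;> simp [mult, mul_comm, ss_ne]
  rw [e0, e1, Finset.prod_congr rfl (fun i _ => e2 i)]
  simp only [form, Finset.sum_singleton]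
  ring

end algebra

end

end MilnorBU

namespace MilnorBU

noncomputable section

set_option linter.unusedSectionVars false

section projective
open LinearAlgebra.Projectivization

variable {K : Type} [RCLike K] {d : ℕ}

def ip (v w : Fin d → K) : K := ∑ k, starRingEnd K (v k) * w k

theorem ip_self (v : Fin d → K) : ip v v = ((∑ k, ‖v k‖ ^ 2 : ℝ) : K) := by
  unfold ip
  push_cast
  refine Finset.sum_congr rfl (fun k _ => ?_)
  exact RCLike.conj_mul (v k)

theorem ip_self_ne {v : Fin d → K} (hv : v ≠ 0) : ip v v ≠ 0 := by
  rw [ip_self]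
  intro h
  apply hv
  have h1 : (∑ k, ‖v k‖ ^ 2 : ℝ) = 0 := by exact_mod_cast h
  rw [Finset.sum_eq_zero_iff_of_nonneg (fun _ _ => by positivity)] at h1
  funext k
  simpa using h1 k (Finset.mem_univ k)

theorem ip_smul_left (a : K) (v w : Fin d → K) : ip (a • v) w = starRingEnd K a * ip v w := by
  simp [ip, Finset.mul_sum, mul_assoc]

theorem ip_smul_right (a : K) (v w : Fin d → K) : ip v (a • w) = a * ip v w := by
  simp only [ip, Finset.mul_sum, Pi.smul_apply, smul_eq_mul]
  exact Finset.sum_congr rfl (fun k _ => by ring)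

theorem ip_conj (v w : Fin d → K) : starRingEnd K (ip v w) = ip w v := by
  simp [ip, map_sum, mul_comm]

theorem ip_neg_right (v w : Fin d → K) : ip v (-w) = - ip v w := by
  simp [ip]

theorem ip_neg_left (v w : Fin d → K) : ip (-v) w = - ip v w := by
  simp [ip]

theorem continuous_mk {V : Type*} [AddCommGroup V] [Module K V] [TopologicalSpace V] :
    Continuous (Projectivization.mk' K : {v : V // v ≠ 0} → Projectivization K V) :=
  continuous_quot_mk

theorem quotMap_mk {V : Type*} [AddCommGroup V] [Module K V] [TopologicalSpace V] :
    Topology.IsQuotientMap (Projectivization.mk' K : {v : V // v ≠ 0} → Projectivization K V) :=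
  isQuotientMap_quot_mk

def PM (p : Projectivization K (Fin d → K)) (a b : Fin d) : K :=
  p.rep a * starRingEnd K (p.rep b) / ip p.rep p.rep

theorem PM_mk (v : Fin d → K) (hv : v ≠ 0) (a b : Fin d) :
    PM (Projectivization.mk K v hv) a b = v a * starRingEnd K (v b) / ip v v := by
  obtain ⟨c, hc⟩ := Projectivization.exists_smul_eq_mk_rep K v hv
  have hc0 : (c : K) ≠ 0 := c.ne_zero
  have hc1 : starRingEnd K (c : K) ≠ 0 := by simp
  unfold PM
  rw [← hc]
  have : (c • v : Fin d → K) = (c : K) • v := rfl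
  rw [this, ip_smul_left, ip_smul_right]
  simp only [Pi.smul_apply, smul_eq_mul, map_mul]
  have := ip_self_ne hv
  field_simp

theorem continuous_ip {T : Type*} [TopologicalSpace T] {f g : T → Fin d → K} (hf : Continuous f)
    (hg : Continuous g) : Continuous (fun t => ip (f t) (g t)) := by
  unfold ip
  refine continuous_finsetSum _ (fun k _ => ?_)
  have h1 : Continuous fun t => f t k := by fun_prop
  have h2 : Continuous fun t => g t k := by fun_prop
  exact (RCLike.continuous_conj.comp h1).mul h2

theorem continuous_PM (a b : Fin d) :
    Continuous (fun p : Projectivization K (Fin d → K) => PM p a b) := by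
  rw [quotMap_mk.continuous_iff]
  have : ((fun p : Projectivization K (Fin d → K) => PM p a b) ∘ Projectivization.mk' K)
      = fun v : {v : Fin d → K // v ≠ 0} => v.1 a * starRingEnd K (v.1 b) / ip v.1 v.1 := by
    funext v
    exact PM_mk v.1 v.2 a b
  rw [this]
  refine Continuous.div ?_ (continuous_ip continuous_subtype_val continuous_subtype_val)
    (fun v => ip_self_ne v.2)
  have h1 : Continuous fun t : {v : Fin d → K // v ≠ 0} => t.1 a := (continuous_apply a).comp continuous_subtype_val
  have h2 : Continuous fun t : {v : Fin d → K // v ≠ 0} => t.1 b := (continuous_apply b).comp continuous_subtype_val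
  exact h1.mul (RCLike.continuous_conj.comp h2)

/-- orthogonal projection onto the line `p` -/
def PV (p : Projectivization K (Fin d → K)) (v : Fin d → K) : Fin d → K :=
  fun a => ∑ b, PM p a b * v b

theorem continuous_PV {T : Type*} [TopologicalSpace T] {f : T → Projectivization K (Fin d → K)}
    {g : T → Fin d → K} (hf : Continuous f) (hg : Continuous g) :
    Continuous (fun t => PV (f t) (g t)) := by
  unfold PV
  refine continuous_pi (fun a => continuous_finsetSum _ (fun b _ => ?_))
  have h2 : Continuous fun t => g t b := by fun_prop
  exact ((continuous_PM a b).comp hf).mul h2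

theorem PV_mk (v : Fin d → K) (hv : v ≠ 0) (w : Fin d → K) :
    PV (Projectivization.mk K v hv) w = (ip v w / ip v v) • v := by
  funext a
  simp only [PV, PM_mk, Pi.smul_apply, smul_eq_mul]
  rw [show ip v w = ∑ k, starRingEnd K (v k) * w k from rfl, Finset.sum_div, Finset.sum_mul]
  exact Finset.sum_congr rfl (fun k _ => by ring)

theorem PV_neg (p : Projectivization K (Fin d → K)) (w : Fin d → K) : PV p (-w) = - PV p w := by
  funext a
  simp [PV]

def ov (p q : Projectivization K (Fin d → K)) : K := ∑ a, ∑ b, PM p a b * PM q b a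

theorem continuous_ov {T : Type*} [TopologicalSpace T] {f g : T → Projectivization K (Fin d → K)}
    (hf : Continuous f) (hg : Continuous g) : Continuous (fun t => ov (f t) (g t)) := by
  unfold ov
  exact continuous_finsetSum _ (fun a _ => continuous_finsetSum _ (fun b _ =>
    ((continuous_PM a b).comp hf).mul ((continuous_PM b a).comp hg)))

theorem ov_mk (v w : Fin d → K) (hv : v ≠ 0) (hw : w ≠ 0) :
    ov (Projectivization.mk K v hv) (Projectivization.mk K w hw)
      = (ip w v / ip w w) * (ip v w / ip v v) := by
  simp only [ov, PM_mk]
  have e : ip w v * ip v w = ∑ a, ∑ b, v a * starRingEnd K (v b) * (w b * starRingEnd K (w a)) := by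
    rw [ip, ip, Finset.sum_mul_sum]
    refine Finset.sum_congr rfl (fun a _ => Finset.sum_congr rfl (fun b _ => by ring))
  rw [div_mul_div_comm, e, Finset.sum_div]
  refine Finset.sum_congr rfl (fun a _ => ?_)
  rw [Finset.sum_div]
  exact Finset.sum_congr rfl (fun b _ => by ring)

theorem ov_self (p : Projectivization K (Fin d → K)) : ov p p = 1 := by
  induction p using Projectivization.ind with
  | h v hv =>
  rw [ov_mk, div_self (ip_self_ne hv), one_mul]

/-- successive projections -/
def chain (γ : ℕ → Projectivization K (Fin d → K)) (v : Fin d → K) : ℕ → Fin d → K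
  | 0 => v
  | j + 1 => PV (γ (j + 1)) (chain γ v j)

theorem chain_neg (γ : ℕ → Projectivization K (Fin d → K)) (v : Fin d → K) (j : ℕ) :
    chain γ (-v) j = - chain γ v j := by
  induction j with
  | zero => rfl
  | succ j ih => rw [chain, ih, PV_neg, chain]

theorem chain_cont {T : Type*} [TopologicalSpace T]
    {γ : T → ℕ → Projectivization K (Fin d → K)} {v : T → Fin d → K}
    (hγ : ∀ j, Continuous fun t => γ t j) (hv : Continuous v) (j : ℕ) :
    Continuous fun t => chain (γ t) (v t) j := by
  induction j with
  | zero => exact hv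
  | succ j ih => exact continuous_PV (hγ (j + 1)) ih

theorem chain_ne (γ : ℕ → Projectivization K (Fin d → K)) (v : Fin d → K) (hv : v ≠ 0)
    (h0 : γ 0 = Projectivization.mk K v hv) (hov : ∀ j, ov (γ j) (γ (j + 1)) ≠ 0) (j : ℕ) :
    ∃ h : chain γ v j ≠ 0, γ j = Projectivization.mk K (chain γ v j) h := by
  induction j with
  | zero => exact ⟨hv, h0⟩
  | succ j ih =>
    obtain ⟨h1, h2⟩ := ih
    have h3 := hov j
    rw [h2] at h3
    rw [chain]
    generalize γ (j + 1) = p at h3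
    induction p using Projectivization.ind with
    | h w hw =>
    rw [ov_mk _ _ h1 hw] at h3
    have h4 := left_ne_zero_of_mul h3
    rw [PV_mk]
    have h5 : (ip w (chain γ v j) / ip w w) • w ≠ 0 := smul_ne_zero h4 hw
    refine ⟨h5, ?_⟩
    rw [Projectivization.mk_eq_mk_iff']
    exact ⟨(ip w (chain γ v j) / ip w w)⁻¹, by rw [smul_smul, inv_mul_cancel₀ h4, one_smul]⟩

theorem pairing_ne (γ : ℕ → Projectivization K (Fin d → K)) (v w : Fin d → K) (hv : v ≠ 0)
    (hw : w ≠ 0) (j : ℕ)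
    (h0 : γ 0 = Projectivization.mk K v hv) (hov : ∀ j, ov (γ j) (γ (j + 1)) ≠ 0)
    (hj : γ j = Projectivization.mk K w hw) : ip w (chain γ v j) ≠ 0 := by
  obtain ⟨h1, h2⟩ := chain_ne γ v hv h0 hov j
  rw [hj, Projectivization.mk_eq_mk_iff'] at h2
  obtain ⟨a, ha⟩ := h2
  rw [← ha, ip_smul_left]
  refine mul_ne_zero ?_ (ip_self_ne h1)
  intro h
  have : a = 0 := by simpa using h
  rw [this, zero_smul] at ha
  exact hw ha.symm

end projective

end

end MilnorBU

namespace MilnorBU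

noncomputable section

set_option linter.unusedSectionVars false

section milnor

variable {K : Type} [RCLike K] {E : Bool → ℕ}

/-- common form of the Milnor manifolds -/
def Mil (K : Type) [RCLike K] (E : Bool → ℕ) :
    Set (Projectivization K (Fin (E true + 1) → K) × Projectivization K (Fin (E false + 1) → K)) :=
  {p | ∑ i : Fin (min (E false + 1) (E true + 1)),
      p.1.rep (Fin.castLE (min_le_right _ _) i) *
        (starRingEnd K) (p.2.rep (Fin.castLE (min_le_left _ _) i)) = 0}

/-- extension by zero -/
def ex (y : Fin (E false + 1) → K) : Fin (E true + 1) → K :=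
  fun a => if h : (a : ℕ) < E false + 1 then y ⟨a, h⟩ else 0

theorem ex_smul (a : K) (y : Fin (E false + 1) → K) :
    (ex (a • y) : Fin (E true + 1) → K) = a • ex y := by
  funext i
  simp only [ex, Pi.smul_apply, smul_eq_mul]
  split_ifs <;> simp

theorem ex_neg (y : Fin (E false + 1) → K) :
    (ex (-y) : Fin (E true + 1) → K) = - ex y := by
  funext i
  simp only [ex, Pi.neg_apply]
  split_ifs <;> simp

theorem ex_ne (hE : E false ≤ E true) {y : Fin (E false + 1) → K} (hy : y ≠ 0) :
    (ex y : Fin (E true + 1) → K) ≠ 0 := by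
  intro h
  apply hy
  funext i
  have := congrFun h ⟨i, by omega⟩
  simpa [ex, Nat.le_of_lt_succ i.2] using this

theorem ex_cont : Continuous (ex : (Fin (E false + 1) → K) → Fin (E true + 1) → K) := by
  refine continuous_pi (fun a => ?_)
  unfold ex
  split_ifs
  · fun_prop
  · exact continuous_const

theorem sum_eq_ip (hE : E false ≤ E true) (x : Fin (E true + 1) → K) (y : Fin (E false + 1) → K) :
    ∑ i : Fin (min (E false + 1) (E true + 1)),
      x (Fin.castLE (min_le_right _ _) i) *
        (starRingEnd K) (y (Fin.castLE (min_le_left _ _) i)) = ip (ex y) x := by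
  unfold ip
  refine Fintype.sum_of_injective (Fin.castLE (min_le_right _ _)) (Fin.castLE_injective _) _ _ ?_ ?_
  · intro a ha
    have : ¬ ((a : ℕ) < E false + 1) := by
      intro h
      exact ha ⟨⟨a, by omega⟩, by ext; simp⟩
    simp [ex, this]
  · intro i
    have : (i : ℕ) < E false + 1 := by omega
    simp only [ex, Fin.val_castLE, this, dif_pos]
    rw [mul_comm]
    rfl

theorem mem_Mil (hE : E false ≤ E true) (x : Fin (E true + 1) → K) (y : Fin (E false + 1) → K)
    (hx : x ≠ 0) (hy : y ≠ 0) :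
    (Projectivization.mk K x hx, Projectivization.mk K y hy) ∈ Mil K E ↔ ip (ex y) x = 0 := by
  unfold Mil
  rw [Set.mem_ofPred_eq, sum_eq_ip hE]
  obtain ⟨a, ha⟩ := Projectivization.exists_smul_eq_mk_rep K x hx
  obtain ⟨b, hb⟩ := Projectivization.exists_smul_eq_mk_rep K y hy
  rw [← ha, ← hb]
  have h1 : (a • x : Fin (E true + 1) → K) = (a : K) • x := rfl
  have h2 : (b • y : Fin (E false + 1) → K) = (b : K) • y := rfl
  rw [h1, h2, ex_smul, ip_smul_left, ip_smul_right]
  simp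

def pr (b : Bool) (p : Mil K E) : Projectivization K (Fin (E b + 1) → K) :=
  match b with
  | true => p.1.1
  | false => p.1.2

theorem pr_cont (b : Bool) : Continuous (pr b : Mil K E → _) := by
  cases b
  · exact continuous_snd.comp continuous_subtype_val
  · exact continuous_fst.comp continuous_subtype_val

def ret (x : Fin (E true + 1) → K) (y : Fin (E false + 1) → K) : Fin (E true + 1) → K :=
  x - (ip (ex y) x / ip (ex y) (ex y)) • (ex y)

theorem ip_sub_right {d : ℕ} (v w w' : Fin d → K) : ip v (w - w') = ip v w - ip v w' := by
  simp [ip, mul_sub]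

theorem ip_ret (hE : E false ≤ E true) (x : Fin (E true + 1) → K) {y : Fin (E false + 1) → K}
    (hy : y ≠ 0) : ip (ex y) (ret x y) = 0 := by
  rw [ret, ip_sub_right, ip_smul_right, div_mul_cancel₀ _ (ip_self_ne (ex_ne hE hy)), sub_self]

theorem ret_of_zero {x : Fin (E true + 1) → K} {y : Fin (E false + 1) → K}
    (h : ip (ex y) x = 0) : ret x y = x := by
  simp [ret, h]

theorem ret_neg_left (x : Fin (E true + 1) → K) (y : Fin (E false + 1) → K) :
    ret (-x) y = - ret x y := by
  unfold ret
  rw [ip_neg_right, neg_div, neg_smul]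
  abel

theorem ret_neg_right (x : Fin (E true + 1) → K) (y : Fin (E false + 1) → K) :
    ret x (-y) = ret x y := by
  unfold ret
  rw [ex_neg, ip_neg_left, ip_neg_left, ip_neg_right, neg_neg, neg_div, smul_neg, neg_smul, neg_neg]

variable {k : ℕ}

abbrev VV (K : Type) [RCLike K] (E : Bool → ℕ) (k : ℕ) : Type :=
  ∀ l : Fin (k + 2) × Bool, Fin (E l.2 + 1) → K

/-- lift of the coordinates -/
def lft (b : Bool) (i : Fin (k + 2)) (z : VV K E k) : Fin (E b + 1) → K :=
  match b with
  | true => ret (z (i, true)) (z (i, false))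
  | false => z (i, false)

def Dom (K : Type) [RCLike K] (E : Bool → ℕ) (k : ℕ) : Set (VV K E k) :=
  {z | (∀ i, z (i, false) ≠ 0) ∧ ∀ b i, lft b i z ≠ 0}

theorem lft_contOn (hE : E false ≤ E true) (b : Bool) (i : Fin (k + 2)) :
    ContinuousOn (lft b i : VV K E k → _) {z | ∀ i, z (i, false) ≠ 0} := by
  cases b
  · exact (continuous_apply (i, false)).continuousOn
  · rw [continuousOn_iff_continuous_domRestrict]
    have h1 : Continuous fun z : {z : VV K E k | ∀ i, z (i, false) ≠ 0} => z.1 (i, true) :=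
      (continuous_apply (i, true)).comp continuous_subtype_val
    have h2 : Continuous fun z : {z : VV K E k | ∀ i, z (i, false) ≠ 0} => z.1 (i, false) :=
      (continuous_apply (i, false)).comp continuous_subtype_val
    have h3 : Continuous fun z : {z : VV K E k | ∀ i, z (i, false) ≠ 0} =>
      (ex (z.1 (i, false)) : Fin (E true + 1) → K) := ex_cont.comp h2
    exact h1.sub (((continuous_ip h3 h1).div (continuous_ip h3 h3)
      (fun z => ip_self_ne (ex_ne hE (z.2 i)))).smul h3)

theorem Dom_open (hE : E false ≤ E true) : IsOpen (Dom K E k) := by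
  have h0 : IsOpen {z : VV K E k | ∀ i, z (i, false) ≠ 0} := by
    have : {z : VV K E k | ∀ i, z (i, false) ≠ 0} = ⋂ i, {z : VV K E k | z (i, false) ≠ 0} := by
      ext; simp
    rw [this]
    exact isOpen_iInter_of_finite (fun i => isOpen_ne.preimage (continuous_apply (i, false)))
  have : Dom K E k = ⋂ b, ⋂ i, ({z : VV K E k | ∀ i, z (i, false) ≠ 0} ∩ lft b i ⁻¹' {0}ᶜ) := by
    ext z
    simp only [Dom, Set.mem_ofPred_eq, Set.mem_iInter, Set.mem_inter_iff, Set.mem_preimage,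
      Set.mem_compl_iff, Set.mem_singleton_iff]
    constructor
    · exact fun h b i => ⟨h.1, h.2 b i⟩
    · exact fun h => ⟨(h true 0).1, fun b i => (h b i).2⟩
  rw [this]
  exact isOpen_iInter_of_finite (fun b => isOpen_iInter_of_finite (fun i =>
    (lft_contOn hE b i).isOpen_inter_preimage h0 isOpen_compl_singleton))

theorem lft_cont (hE : E false ≤ E true) (b : Bool) (i : Fin (k + 2)) :
    Continuous fun z : Dom K E k => lft b i z.1 := by
  have := (lft_contOn (K := K) hE b i).mono (fun z (hz : z ∈ Dom K E k) => hz.1)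
  exact continuousOn_iff_continuous_domRestrict.1 this

def um (hE : E false ≤ E true) (z : Dom K E k) : Fin (k + 2) → Mil K E := fun i =>
  ⟨(Projectivization.mk K (lft true i z.1) (z.2.2 true i),
    Projectivization.mk K (lft false i z.1) (z.2.2 false i)),
    (mem_Mil hE _ _ _ _).2 (ip_ret hE _ (z.2.1 i))⟩

theorem um_cont (hE : E false ≤ E true) : Continuous (um hE : Dom K E k → _) := by
  refine continuous_pi (fun i => Continuous.subtype_mk (Continuous.prodMk ?_ ?_) _)
  · exact continuous_mk.comp ((lft_cont hE true i).subtype_mk (fun z => z.2.2 true i))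
  · exact continuous_mk.comp ((lft_cont hE false i).subtype_mk (fun z => z.2.2 false i))

theorem pr_um (hE : E false ≤ E true) (z : Dom K E k) (b : Bool) (i : Fin (k + 2)) :
    pr b (um hE z i) = Projectivization.mk K (lft b i z.1) (z.2.2 b i) := by
  cases b <;> rfl

theorem lft_Tn (b : Bool) (i : Fin (k + 2)) (l : Fin (k + 2) × Bool) (z : VV K E k) :
    lft b i (Tn l z) = if l = (i, b) then - lft b i z else lft b i z := by
  cases b
  · by_cases h : l = (i, false)
    · subst h
      simp [lft, Tn_same]
    · rw [if_neg h]
      simp [lft, Tn_ne (Ne.symm h)]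
  · by_cases h : l = (i, true)
    · subst h
      rw [if_pos rfl]
      simp only [lft]
      rw [Tn_same, Tn_ne (by simp), ret_neg_left]
    · rw [if_neg h]
      simp only [lft]
      rw [Tn_ne (Ne.symm h)]
      by_cases h' : l = (i, false)
      · subst h'
        rw [Tn_same, ret_neg_right]
      · rw [Tn_ne (Ne.symm h')]

theorem Tn_Dom (l : Fin (k + 2) × Bool) {z : VV K E k} (hz : z ∈ Dom K E k) :
    Tn l z ∈ Dom K E k := by
  constructor
  · intro i
    have := lft_Tn (K := K) (E := E) false i l z
    simp only [lft] at this
    rw [this]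
    have := hz.1 i
    split_ifs
    · exact neg_ne_zero.2 this
    · exact this
  · intro b i
    rw [lft_Tn]
    have := hz.2 b i
    split_ifs
    · exact neg_ne_zero.2 this
    · exact this

theorem mk_neg' {d : ℕ} (v : Fin d → K) (hv : v ≠ 0) (hv' : -v ≠ 0) :
    Projectivization.mk K (-v) hv' = Projectivization.mk K v hv := by
  rw [Projectivization.mk_eq_mk_iff']
  exact ⟨-1, by simp⟩

theorem um_Tn (hE : E false ≤ E true) (l : Fin (k + 2) × Bool) {z : VV K E k}
    (hz : z ∈ Dom K E k) (hz' : Tn l z ∈ Dom K E k) :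
    um hE ⟨Tn l z, hz'⟩ = um hE ⟨z, hz⟩ := by
  have key : ∀ b i, pr b (um hE ⟨Tn l z, hz'⟩ i) = pr b (um hE ⟨z, hz⟩ i) := by
    intro b i
    rw [pr_um, pr_um]
    have := lft_Tn b i l z
    by_cases h : l = (i, b)
    · rw [if_pos h] at this
      simp only [this]
      exact mk_neg' _ _ _
    · rw [if_neg h] at this
      simp only [this]
  funext i
  exact Subtype.ext (Prod.ext (key true i) (key false i))

end milnor

end

end MilnorBU

namespace MilnorBU

noncomputable section

set_option linter.unusedSectionVars false

section lower

variable {K : Type} [RCLike K] {E : Bool → ℕ} {k : ℕ}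

/-- sample times between `0` and `i / (n - 1)` -/
def tau (J : ℕ) (i : Fin (k + 2)) (j : ℕ) : I :=
  Set.projIcc (0 : ℝ) 1 zero_le_one (((i : ℕ) : ℝ) / (((k + 2 : ℕ) : ℝ) - 1) * (j / (J + 1)))

theorem tau_zero (J : ℕ) (i : Fin (k + 2)) :
    tau J i 0 = Set.projIcc (0 : ℝ) 1 zero_le_one ((((0 : Fin (k + 2)) : ℕ) : ℝ) / (((k + 2 : ℕ) : ℝ) - 1)) := by
  simp [tau]

theorem tau_end (J : ℕ) (i : Fin (k + 2)) :
    tau J i (J + 1) = Set.projIcc (0 : ℝ) 1 zero_le_one (((i : ℕ) : ℝ) / (((k + 2 : ℕ) : ℝ) - 1)) := by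
  unfold tau
  have : ((J + 1 : ℕ) : ℝ) / (J + 1) = 1 := by push_cast; exact div_self (by positivity)
  rw [this, mul_one]

theorem tau_dist (J : ℕ) (i : Fin (k + 2)) (j : ℕ) :
    dist (tau J i j) (tau J i (j + 1)) ≤ 1 / (J + 1) := by
  have h1 : dist (tau J i j) (tau J i (j + 1)) ≤
      dist (((i : ℕ) : ℝ) / (((k + 2 : ℕ) : ℝ) - 1) * (j / (J + 1)))
        (((i : ℕ) : ℝ) / (((k + 2 : ℕ) : ℝ) - 1) * ((j + 1 : ℕ) / (J + 1))) := by
    have := (LipschitzWith.projIcc (zero_le_one' ℝ)).dist_le_mul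
      (((i : ℕ) : ℝ) / (((k + 2 : ℕ) : ℝ) - 1) * (j / (J + 1)))
      (((i : ℕ) : ℝ) / (((k + 2 : ℕ) : ℝ) - 1) * ((j + 1 : ℕ) / (J + 1)))
    simp only [NNReal.coe_one, one_mul] at this
    exact this
  refine h1.trans ?_
  rw [dist_comm, Real.dist_eq]
  have hi : ((i : ℕ) : ℝ) ≤ k + 1 := by
    have := i.2
    exact_mod_cast (by omega : (i : ℕ) ≤ k + 1)
  have h2 : ((i : ℕ) : ℝ) / (((k + 2 : ℕ) : ℝ) - 1) ≤ 1 := by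
    push_cast
    rw [div_le_one (by linarith [(Nat.cast_nonneg k : (0 : ℝ) ≤ k)])]
    linarith
  have h3 : 0 ≤ ((i : ℕ) : ℝ) / (((k + 2 : ℕ) : ℝ) - 1) := by
    apply div_nonneg (Nat.cast_nonneg _)
    push_cast
    linarith [(Nat.cast_nonneg k : (0 : ℝ) ≤ k)]
  have h4 : ((i : ℕ) : ℝ) / (((k + 2 : ℕ) : ℝ) - 1) * ((j + 1 : ℕ) / (J + 1)) -
      ((i : ℕ) : ℝ) / (((k + 2 : ℕ) : ℝ) - 1) * (j / (J + 1))
      = ((i : ℕ) : ℝ) / (((k + 2 : ℕ) : ℝ) - 1) * (1 / (J + 1)) := by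
    push_cast; ring
  rw [h4, abs_of_nonneg (by positivity)]
  exact mul_le_of_le_one_left (by positivity) h2

/-- total overlap of a path at two times -/
def ovt (γ : C(I, Mil K E)) (t t' : I) : K :=
  ov (pr true (γ t)) (pr true (γ t')) * ov (pr false (γ t)) (pr false (γ t'))

theorem ovt_cont {T : Type*} [TopologicalSpace T] {γ : T → C(I, Mil K E)} {f g : T → I}
    (hγ : Continuous γ) (hf : Continuous f) (hg : Continuous g) :
    Continuous fun t => ovt (γ t) (f t) (g t) := by
  unfold ovt
  have h1 : Continuous fun t => (γ t) (f t) := hγ.eval hf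
  have h2 : Continuous fun t => (γ t) (g t) := hγ.eval hg
  exact (continuous_ov ((pr_cont true).comp h1) ((pr_cont true).comp h2)).mul
    (continuous_ov ((pr_cont false).comp h1) ((pr_cont false).comp h2))

theorem ovt_ne {γ : C(I, Mil K E)} {t t' : I} (h : ovt γ t t' ≠ 0) (b : Bool) :
    ov (pr b (γ t)) (pr b (γ t')) ≠ 0 := by
  cases b
  · exact right_ne_zero_of_mul h
  · exact left_ne_zero_of_mul h

def good (J : ℕ) : Set C(I, Mil K E) :=
  {γ | ∀ t t' : I, dist t t' ≤ 1 / ((J : ℝ) + 1) → ovt γ t t' ≠ 0}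

theorem good_open (J : ℕ) : IsOpen (good J : Set C(I, Mil K E)) := by
  rw [isOpen_iff_mem_nhds]
  intro γ hγ
  have hK : IsCompact {p : I × I | dist p.1 p.2 ≤ 1 / ((J : ℝ) + 1)} :=
    (isClosed_le (by fun_prop) continuous_const).isCompact
  have := hK.eventually_forall_of_forall_eventually (x₀ := γ)
    (P := fun γ p => ovt γ p.1 p.2 ≠ 0) (by
      intro p hp
      have hc : Continuous fun q : C(I, Mil K E) × (I × I) => ovt q.1 q.2.1 q.2.2 :=
        ovt_cont continuous_fst (by fun_prop) (by fun_prop)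
      exact hc.continuousAt.eventually_ne (hγ p.1 p.2 hp))
  filter_upwards [this] with δ hδ
  intro t t' h
  exact hδ (t, t') h

theorem good_mono {J J' : ℕ} (h : J ≤ J') : (good J : Set C(I, Mil K E)) ⊆ good J' := by
  intro γ hγ t t' ht
  refine hγ t t' (ht.trans ?_)
  have : (J : ℝ) ≤ J' := by exact_mod_cast h
  exact one_div_le_one_div_of_le (by positivity) (by linarith)

theorem good_exists (γ : C(I, Mil K E)) : ∃ J, γ ∈ good J := by
  have hc : Continuous fun q : I × I => ovt γ q.1 q.2 :=
    ovt_cont continuous_const continuous_fst continuous_snd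
  have hu := CompactSpace.uniformContinuous_of_continuous hc
  obtain ⟨δ, hδ, H⟩ := Metric.uniformContinuous_iff.1 hu 1 one_pos
  obtain ⟨J, hJ⟩ := exists_nat_one_div_lt hδ
  refine ⟨J, fun t t' ht h0 => ?_⟩
  have := @H (t, t') (t, t) (by
    rw [Prod.dist_eq, dist_self, dist_comm]
    simp only
    exact max_lt hδ (by rw [dist_comm, dist_comm t']; exact ht.trans_lt hJ))
  have h1 : ovt γ t t = 1 := by simp [ovt, ov_self]
  change dist (ovt γ t t') (ovt γ t t) < 1 at this
  rw [h0, h1] at this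
  simp at this

set_option maxHeartbeats 2000000 in
theorem lower (hBU : BUProp K) (hE : E false ≤ E true) (c : Bool)
    (hcoef : MvPolynomial.coeff (Finsupp.equivFunOnFinite.symm (fun l : Fin (k + 2) × Bool => E l.2))
      ((∏ i : Fin (k + 2), form {(i, true), (i, false)}) *
        ((∏ z : ZZ k c E, form {(0, z.1.2), z.1}) *
          (form {(0, c)} * form {(1, !c)}))) = 1)
    (k0 : ℕ) (hk0 : k0 ≤ Fintype.card (ZZ k c E))
    (U : Fin k0 → Set (Fin (k + 2) → Mil K E)) (hUo : ∀ i, IsOpen (U i))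
    (hcov : (⋃ i, U i) = Set.univ)
    (hsec : ∀ i, ∃ sec : C(U i, C(I, Mil K E)), ∀ u : U i,
      tcPi (Mil K E) (k + 2) (sec u) = (u : Fin (k + 2) → Mil K E)) : False := by
  classical
  choose sec hs using hsec
  obtain ⟨Q, hQc, hQ0, hQ⟩ := hBU (Fin (k + 2) × Bool) (fun l => E l.2)
  -- bilinear functions
  let β : Fin (k + 2) → VV K E k → K := fun i z => ip (ex (z (i, false))) (z (i, true))
  have hβc : ∀ i, Continuous (β i) := fun i =>
    continuous_ip (ex_cont.comp (continuous_apply (i, false))) (continuous_apply (i, true))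
  let Q0 : Set (VV K E k) := Q ∩ {z | ∀ i, β i z = 0}
  have hQ0c : IsCompact Q0 := by
    apply hQc.inter_right
    have : {z : VV K E k | ∀ i, β i z = 0} = ⋂ i, {z | β i z = 0} := by ext; simp
    rw [this]
    exact isClosed_iInter (fun i => isClosed_eq (hβc i) continuous_const)
  have hQD : ∀ z ∈ Q0, z ∈ Dom K E k := by
    rintro z ⟨hz, hz'⟩
    refine ⟨fun i => hQ0 z hz _, fun b i => ?_⟩
    cases b
    · exact hQ0 z hz _
    · change ret _ _ ≠ 0
      rw [ret_of_zero (hz' i)]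
      exact hQ0 z hz _
  -- the open sets on which the functions live
  let Sj : Fin k0 → Set (Dom K E k) := fun j => um hE ⁻¹' (U j)
  have hSjo : ∀ j, IsOpen (Sj j) := fun j => (hUo j).preimage (um_cont hE)
  let pth : ∀ j, Sj j → C(I, Mil K E) := fun j z => sec j ⟨um hE z.1, z.2⟩
  have pth_cont : ∀ j, Continuous (pth j) := fun j =>
    (sec j).continuous.comp (((um_cont hE).comp continuous_subtype_val).subtype_mk _)
  let W : ℕ → Set (VV K E k) := fun J => ⋃ j, Subtype.val '' (Subtype.val '' (pth j ⁻¹' good J))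
  have hWo : ∀ J, IsOpen (W J) := fun J => isOpen_iUnion (fun j =>
    (Dom_open hE).isOpenMap_subtype_val _ ((hSjo j).isOpenMap_subtype_val _
      ((good_open J).preimage (pth_cont j))))
  obtain ⟨J, hJ⟩ := hQ0c.elim_directed_cover W hWo (by
    intro z hz
    have hzD := hQD z hz
    have : um hE ⟨z, hzD⟩ ∈ ⋃ i, U i := by rw [hcov]; trivial
    obtain ⟨j, hj⟩ := Set.mem_iUnion.1 this
    obtain ⟨J, hJ⟩ := good_exists (pth j ⟨⟨z, hzD⟩, hj⟩)
    exact Set.mem_iUnion.2 ⟨J, Set.mem_iUnion.2 ⟨j, ⟨_, ⟨_, hJ, rfl⟩, rfl⟩⟩⟩) (by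
    apply directed_of_isDirected_le
    intro J J' h
    exact Set.iUnion_mono (fun j => Set.image_mono (Set.image_mono
      (Set.preimage_mono (good_mono h)))))
  -- the functions
  let g : ∀ (j : Fin k0) (i : Fin (k + 2)) (b : Bool), Sj j → K := fun j i b z =>
    ip (lft b i z.1.1) (chain (fun t => pr b (pth j z (tau J i t))) (lft b 0 z.1.1) (J + 1))
  have g_cont : ∀ j i b, Continuous (g j i b) := by
    intro j i b
    have l1 : ∀ i', Continuous fun z : Sj j => lft b i' z.1.1 := fun i' =>
      (lft_cont hE b i').comp continuous_subtype_val
    refine continuous_ip (l1 i) (chain_cont (fun t => ?_) (l1 0) _)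
    exact (pr_cont b).comp ((pth_cont j).eval continuous_const)
  let hh : ∀ (j : Fin k0) (i : Fin (k + 2)) (b : Bool), VV K E k → K := fun j i b z =>
    if hz : ∃ h : z ∈ Dom K E k, (⟨z, h⟩ : Dom K E k) ∈ Sj j then g j i b ⟨⟨z, hz.1⟩, hz.2⟩ else 0
  have hh_pos : ∀ j i b z (h : z ∈ Dom K E k) (h' : (⟨z, h⟩ : Dom K E k) ∈ Sj j),
      hh j i b z = g j i b ⟨⟨z, h⟩, h'⟩ := fun j i b z h h' => dif_pos ⟨h, h'⟩
  have hh_cont : ∀ j i b z (h : z ∈ Dom K E k) (h' : (⟨z, h⟩ : Dom K E k) ∈ Sj j),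
      ContinuousAt (hh j i b) z := by
    intro j i b z h h'
    have o1 : Topology.IsOpenEmbedding (fun w : Sj j => (w.1.1 : VV K E k)) :=
      (Dom_open hE).isOpenEmbedding_subtypeVal.comp (hSjo j).isOpenEmbedding_subtypeVal
    have := o1.continuousAt_iff (g := hh j i b) (x := (⟨⟨z, h⟩, h'⟩ : Sj j))
    rw [← this]
    have e : (hh j i b ∘ fun w : Sj j => (w.1.1 : VV K E k)) = g j i b := by
      funext w
      exact hh_pos j i b w.1.1 w.1.2 w.2
    rw [e]
    exact (g_cont j i b).continuousAt
  have hh_Tn : ∀ j i b (l : Fin (k + 2) × Bool) (z : VV K E k), i ≠ 0 →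
      hh j i b (Tn l z) = if l ∈ ({(0, b), (i, b)} : Finset (Fin (k + 2) × Bool)) then
        - hh j i b z else hh j i b z := by
    intro j i b l z hi
    by_cases hz : ∃ h : z ∈ Dom K E k, (⟨z, h⟩ : Dom K E k) ∈ Sj j
    · obtain ⟨h, h'⟩ := hz
      have hT := Tn_Dom l h
      have hu := um_Tn hE l h hT
      have hT' : (⟨Tn l z, hT⟩ : Dom K E k) ∈ Sj j := by
        change um hE _ ∈ U j
        rw [hu]; exact h'
      rw [hh_pos j i b z h h', hh_pos j i b _ hT hT']
      have hp : pth j ⟨⟨Tn l z, hT⟩, hT'⟩ = pth j ⟨⟨z, h⟩, h'⟩ := by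
        simp only [pth, hu]
      simp only [g, hp, lft_Tn]
      by_cases h0 : l = (0, b)
      · have h1 : l ≠ (i, b) := by rw [h0]; intro h; exact hi (congrArg Prod.fst h).symm
        rw [if_pos h0, if_neg h1, if_pos (by simp [h0]), chain_neg, ip_neg_right]
      · by_cases h1 : l = (i, b)
        · rw [if_neg h0, if_pos h1, if_pos (by simp [h1]), ip_neg_left]
        · rw [if_neg h0, if_neg h1, if_neg (by simp [h0, h1])]
    · have hz' : ¬ ∃ h : Tn l z ∈ Dom K E k, (⟨Tn l z, h⟩ : Dom K E k) ∈ Sj j := by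
        rintro ⟨h, h'⟩
        apply hz
        have h2 : Tn l (Tn l z) = z := congrFun (Tn_Tn l) z
        have hD : z ∈ Dom K E k := by
          have := Tn_Dom l h
          rwa [h2] at this
        refine ⟨hD, ?_⟩
        change um hE _ ∈ U j
        rw [← um_Tn hE l hD h]
        exact h'
      have e1 : hh j i b z = 0 := dif_neg hz
      have e2 : hh j i b (Tn l z) = 0 := dif_neg hz'
      rw [e1, e2]; simp
  have hh_ne : ∀ j i b z (h : z ∈ Dom K E k) (h' : (⟨z, h⟩ : Dom K E k) ∈ Sj j),
      pth j ⟨⟨z, h⟩, h'⟩ ∈ good J → hh j i b z ≠ 0 := by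
    intro j i b z h h' hg
    rw [hh_pos j i b z h h']
    have hsj := hs j ⟨um hE ⟨z, h⟩, h'⟩
    refine pairing_ne _ _ _ (h.2 b 0) (h.2 b i) (J + 1) ?_ ?_ ?_
    · rw [← pr_um hE ⟨z, h⟩, tau_zero]
      exact congrArg (pr b) (congrFun hsj 0)
    · intro t
      exact ovt_ne (hg _ _ (tau_dist J i t)) b
    · rw [← pr_um hE ⟨z, h⟩, tau_end]
      exact congrArg (pr b) (congrFun hsj i)
  let e : ZZ k c E ≃ Fin (Fintype.card (ZZ k c E)) := Fintype.equivFin _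
  let ε : Fin (k + 2) ⊕ (ZZ k c E ⊕ Bool) → Finset (Fin (k + 2) × Bool) :=
    Sum.elim (fun i => {(i, true), (i, false)}) (Sum.elim (fun z => {(0, z.1.2), z.1})
      (fun b => if b then {(0, c)} else {(1, !c)}))
  let H : Fin (k + 2) ⊕ (ZZ k c E ⊕ Bool) → VV K E k → K :=
    Sum.elim β (Sum.elim (fun z w => if h : (e z : ℕ) < k0 then hh ⟨e z, h⟩ z.1.1 z.1.2 w else 0)
      (fun _ _ => 0))
  obtain ⟨z, hz, hz'⟩ := hQ (Fin (k + 2) ⊕ (ZZ k c E ⊕ Bool)) ε H (by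
    rintro (i | x | b) l z hz
    · change β i (Tn l z) = if l ∈ ({(i, true), (i, false)} : Finset (Fin (k + 2) × Bool)) then
        - β i z else β i z
      simp only [β]
      by_cases h0 : l = (i, true)
      · subst h0
        rw [Tn_same, Tn_ne (by simp), ip_neg_right]
        simp
      · by_cases h1 : l = (i, false)
        · subst h1
          rw [Tn_same, Tn_ne (by simp), ex_neg, ip_neg_left]
          simp
        · rw [Tn_ne (Ne.symm h0), Tn_ne (Ne.symm h1)]
          simp [h0, h1]
    · change (if h : (e x : ℕ) < k0 then hh ⟨e x, h⟩ x.1.1 x.1.2 (Tn l z) else 0)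
        = if l ∈ ({(0, x.1.2), x.1} : Finset (Fin (k + 2) × Bool)) then
        - (if h : (e x : ℕ) < k0 then hh ⟨e x, h⟩ x.1.1 x.1.2 z else 0) else
          (if h : (e x : ℕ) < k0 then hh ⟨e x, h⟩ x.1.1 x.1.2 z else 0)
      by_cases h : (e x : ℕ) < k0
      · simp only [dif_pos h]
        exact hh_Tn _ _ _ l z (ZZ_ne x)
      · simp only [dif_neg h]
        simp
    · change (0 : K) = if _ then - 0 else 0
      simp) (by
    rw [← hcoef]
    congr 1
    rw [Fintype.prod_sum_type, Fintype.prod_sum_type]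
    congr 2
    rw [Fintype.prod_bool]
    rfl)
  have hzβ : ∀ i, β i z = 0 := by
    intro i
    rcases hz' (Sum.inl i) with h | h
    · exact h
    · exact absurd (hβc i).continuousAt h
  obtain ⟨j, hj⟩ := Set.mem_iUnion.1 (hJ ⟨hz, hzβ⟩)
  obtain ⟨_, ⟨⟨⟨z', h⟩, h'⟩, hg, rfl⟩, rfl⟩ := hj
  let x : ZZ k c E := e.symm ⟨j, lt_of_lt_of_le j.2 hk0⟩
  have hx : (e x : ℕ) = j := by simp [x]
  have hx' : (e x : ℕ) < k0 := by rw [hx]; exact j.2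
  have hx'' : (⟨e x, hx'⟩ : Fin k0) = j := Fin.ext hx
  have hH : H (Sum.inr (Sum.inl x)) = hh j x.1.1 x.1.2 := by
    funext w
    change (if h : (e x : ℕ) < k0 then hh ⟨e x, h⟩ x.1.1 x.1.2 w else 0) = _
    rw [dif_pos hx', hx'']
  rcases hz' (Sum.inr (Sum.inl x)) with h1 | h1
  · rw [hH] at h1
    exact hh_ne j _ _ z' h h' hg h1
  · rw [hH] at h1
    exact h1 (hh_cont j _ _ z' h h')

end lower

end

end MilnorBU

namespace MilnorBU

noncomputable section

set_option linter.unusedSectionVars false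

section upper

theorem near_unique {n : ℕ} {τ : ℝ} {m m' : Fin n} (h : |τ - (m : ℕ)| ≤ 1 / 2)
    (h' : |τ - (m' : ℕ)| < 1 / 2) : m = m' := by
  have h1 := abs_le.1 h
  have h2 := abs_lt.1 h'
  have h3 : ((m : ℕ) : ℝ) < (m' : ℕ) + 1 := by linarith
  have h4 : ((m' : ℕ) : ℝ) < (m : ℕ) + 1 := by linarith
  have h5 : (m : ℕ) < (m' : ℕ) + 1 := by exact_mod_cast h3
  have h6 : (m' : ℕ) < (m : ℕ) + 1 := by exact_mod_cast h4
  ext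
  omega

/-- a section of `tcPi` from contractions of all coordinates to a base point -/
theorem sec_of_contr {X : Type*} [TopologicalSpace X] {n : ℕ} (hn : 2 ≤ n)
    (A : Set (Fin n → X)) (x0 : X)
    (H : ∀ m : Fin n, ∃ h : A × ℝ → X, Continuous h ∧ (∀ u, h (u, 0) = u.1 m) ∧
      ∀ u, h (u, 1) = x0) :
    ∃ sec : C(A, C(I, X)), ∀ u : A, tcPi X n (sec u) = (u : Fin n → X) := by
  classical
  choose h hc h0 h1 using H
  have hn1 : (0 : ℝ) < (n : ℝ) - 1 := by
    have : (2 : ℝ) ≤ n := by exact_mod_cast hn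
    linarith
  let τ : A × I → ℝ := fun q => ((n : ℝ) - 1) * (q.2 : ℝ)
  have hτ : Continuous τ := by fun_prop
  let F : A × I → X := fun q =>
    if hq : ∃ m : Fin n, |τ q - (m : ℕ)| < 1 / 2 then h hq.choose (q.1, 2 * |τ q - (hq.choose : ℕ)|)
    else x0
  have hF : ∀ (m : Fin n) (q : A × I), |τ q - (m : ℕ)| ≤ 1 / 2 →
      F q = h m (q.1, 2 * |τ q - (m : ℕ)|) := by
    intro m q hq
    by_cases hex : ∃ m : Fin n, |τ q - (m : ℕ)| < 1 / 2
    · have := near_unique hq hex.choose_spec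
      simp only [F, dif_pos hex]
      rw [← this]
    · simp only [F, dif_neg hex]
      push Not at hex
      have : |τ q - (m : ℕ)| = 1 / 2 := le_antisymm hq (hex m)
      rw [this]
      norm_num
      exact (h1 m q.1).symm
  have hFc : Continuous F := by
    refine (locallyFinite_of_finite (fun m : Fin n => {q : A × I | |τ q - (m : ℕ)| ≤ 1 / 2})).continuous
      ?_ ?_ ?_
    · rw [Set.iUnion_eq_univ_iff]
      intro q
      have hq0 : 0 ≤ τ q := mul_nonneg hn1.le q.2.2.1
      have hq1 : τ q ≤ (n : ℝ) - 1 := mul_le_of_le_one_right hn1.le q.2.2.2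
      have hr := abs_sub_round (τ q)
      have hr' := abs_le.1 hr
      have a1 : (-1 : ℝ) < round (τ q) := by linarith
      have a2 : (round (τ q) : ℝ) < n := by linarith
      have b1 : -1 < round (τ q) := by exact_mod_cast a1
      have b2 : round (τ q) < n := by exact_mod_cast a2
      refine ⟨⟨(round (τ q)).toNat, by omega⟩, ?_⟩
      have : (((round (τ q)).toNat : ℕ) : ℝ) = round (τ q) := by
        have : (((round (τ q)).toNat : ℕ) : ℤ) = round (τ q) := Int.toNat_of_nonneg (by omega)
        exact_mod_cast this
      simp only [Set.mem_ofPred_eq, this]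
      exact hr
    · intro m
      exact isClosed_le (by fun_prop) continuous_const
    · intro m
      have : Continuous fun q : A × I => h m (q.1, 2 * |τ q - (m : ℕ)|) :=
        (hc m).comp (by fun_prop)
      exact this.continuousOn.congr (fun q hq => hF m q hq)
  refine ⟨ContinuousMap.curry ⟨F, hFc⟩, fun u => ?_⟩
  funext m
  have hm : ((m : ℕ) : ℝ) ≤ (n : ℝ) - 1 := by
    have := m.2
    have : (m : ℕ) + 1 ≤ n := this
    have : ((m : ℕ) : ℝ) + 1 ≤ n := by exact_mod_cast this
    linarith
  have hmem : ((m : ℕ) : ℝ) / ((n : ℝ) - 1) ∈ Set.Icc (0 : ℝ) 1 :=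
    ⟨by positivity, (div_le_one hn1).2 hm⟩
  change F (u, Set.projIcc (0 : ℝ) 1 zero_le_one (((m : ℕ) : ℝ) / ((n : ℝ) - 1))) = _
  rw [Set.projIcc_of_mem _ hmem]
  have : τ (u, ⟨((m : ℕ) : ℝ) / ((n : ℝ) - 1), hmem⟩) = (m : ℕ) := by
    simp only [τ]
    field_simp
  rw [hF m _ (by rw [this]; norm_num), this]
  simp [h0]

theorem sec_glue {X Y : Type*} [TopologicalSpace X] [TopologicalSpace Y] {ι : Type*}
    (π : Y → X) (V : ι → Set X) (hV : ∀ i, IsOpen (V i))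
    (hd : ∀ i j, i ≠ j → Disjoint (V i) (V j))
    (hs : ∀ i, ∃ s : C(V i, Y), ∀ u, π (s u) = u) :
    ∃ s : C((⋃ i, V i : Set X), Y), ∀ u, π (s u) = u := by
  choose s hs using hs
  let S : ι → Set (⋃ i, V i : Set X) := fun i => Subtype.val ⁻¹' (V i)
  let φ : ∀ i, C(S i, Y) := fun i => ⟨fun u => s i ⟨u.1.1, u.2⟩,
    (s i).continuous.comp ((continuous_subtype_val.comp continuous_subtype_val).subtype_mk _)⟩
  have hφ : ∀ (i j) (x : (⋃ i, V i : Set X)) (hxi : x ∈ S i) (hxj : x ∈ S j),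
      φ i ⟨x, hxi⟩ = φ j ⟨x, hxj⟩ := by
    intro i j x hi hj
    by_cases hij : i = j
    · subst hij; rfl
    · exact absurd hj (Set.disjoint_left.1 (hd i j hij) hi)
  have hS : ∀ x : (⋃ i, V i : Set X), ∃ i, S i ∈ nhds x := by
    rintro ⟨x, hx⟩
    obtain ⟨i, hi⟩ := Set.mem_iUnion.1 hx
    exact ⟨i, ((hV i).preimage continuous_subtype_val).mem_nhds hi⟩
  refine ⟨ContinuousMap.liftCover S φ hφ hS, fun u => ?_⟩
  obtain ⟨x, hx⟩ := u
  obtain ⟨i, hi⟩ := Set.mem_iUnion.1 hx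
  have := ContinuousMap.liftCover_coe (S := S) (φ := φ) (hφ := hφ) (hS := hS)
    (⟨⟨x, hx⟩, hi⟩ : S i)
  rw [this]
  exact hs i ⟨x, hi⟩

theorem sep_family {M : Type*} [TopologicalSpace M] [CompletelyNormalSpace M] {ι : Type*} [Finite ι]
    (T : ι → Set M) (h : ∀ i j, i ≠ j → Disjoint (closure (T i)) (T j)) :
    ∃ N : ι → Set M, (∀ i, IsOpen (N i)) ∧ (∀ i, T i ⊆ N i) ∧
      ∀ i j, i ≠ j → Disjoint (N i) (N j) := by
  have h' : ∀ i j, ∃ U V : Set M, IsOpen U ∧ IsOpen V ∧ (T i ⊆ U) ∧ (T j ⊆ V) ∧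
      (i ≠ j → Disjoint U V) := by
    intro i j
    by_cases hij : i = j
    · exact ⟨Set.univ, Set.univ, isOpen_univ, isOpen_univ, Set.subset_univ _, Set.subset_univ _,
        fun h => absurd hij h⟩
    · obtain ⟨U, V, a, b, c, d, e⟩ := separatedNhds_iff_disjoint.2
        (CompletelyNormalSpace.completely_normal (h i j hij) ((h j i (Ne.symm hij)).symm))
      exact ⟨U, V, a, b, c, d, fun _ => e⟩
  choose U V hU hV hTU hTV hUV using h'
  refine ⟨fun i => ⋂ j, (U i j ∩ V j i), fun i => isOpen_iInter_of_finite
    (fun j => (hU i j).inter (hV j i)), fun i => Set.subset_iInter (fun j => Set.subset_inter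
    (hTU i j) (hTV j i)), fun i j hij => ?_⟩
  refine (hUV i j hij).mono ?_ ?_
  · exact (Set.iInter_subset _ j).trans Set.inter_subset_left
  · exact (Set.iInter_subset _ i).trans Set.inter_subset_right

theorem strat_upper {X M P : Type} [TopologicalSpace X] [MetricSpace M] [Fintype P]
    (F : X → M) (hF : Continuous F) (T : P → Set M) (ρ : P → ℕ) (N : ℕ) (hρ : ∀ p, ρ p ≤ N)
    (hT : ∀ x, ∃ p, F x ∈ T p)
    (hsep : ∀ p q, p ≠ q → ρ p ≤ ρ q → Disjoint (closure (T p)) (T q))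
    (C : P → Set X) (hC : ∀ p, IsOpen (C p)) (hTC : ∀ p x, F x ∈ T p → x ∈ C p) (x0 : X)
    (hcontr : ∀ p, ∃ h : C p × ℝ → X, Continuous h ∧ (∀ u, h (u, 0) = u) ∧ ∀ u, h (u, 1) = x0)
    (n : ℕ) (hn : 2 ≤ n) :
    ∃ U : Fin (n * N + 1) → Set (Fin n → X),
    (∀ i, IsOpen (U i)) ∧ (⋃ i, U i) = Set.univ ∧
    ∀ i, ∃ sec : C(U i, C(I, X)), ∀ u : U i, tcPi X n (sec u) = (u : Fin n → X) := by
  classical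
  let ι : ℕ → Type := fun j => {α : Fin n → P // ∑ m, ρ (α m) = j}
  let TT : ∀ j, ι j → Set (Fin n → M) := fun j α => {z | ∀ m, z m ∈ T (α.1 m)}
  have hsepT : ∀ j (α β : ι j), α ≠ β → Disjoint (closure (TT j α)) (TT j β) := by
    intro j α β hαβ
    have : ∃ m, α.1 m ≠ β.1 m ∧ ρ (α.1 m) ≤ ρ (β.1 m) := by
      by_contra! hcon
      have hle : ∀ m, ρ (β.1 m) ≤ ρ (α.1 m) := by
        intro m
        by_cases h : α.1 m = β.1 m
        · rw [h]
        · exact (hcon m h).le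
      obtain ⟨m, hm⟩ : ∃ m, α.1 m ≠ β.1 m := by
        by_contra! h
        exact hαβ (Subtype.ext (funext h))
      have : ∑ m, ρ (β.1 m) < ∑ m, ρ (α.1 m) :=
        Finset.sum_lt_sum (fun m _ => hle m) ⟨m, Finset.mem_univ m, hcon m hm⟩
      rw [α.2, β.2] at this
      exact lt_irrefl _ this
    obtain ⟨m, h1, h2⟩ := this
    have hd := hsep _ _ h1 h2
    rw [Set.disjoint_left] at hd ⊢
    intro z hz hz'
    refine hd ?_ (hz' m)
    have hc : Continuous (fun z : Fin n → M => z m) := continuous_apply m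
    exact hc.closure_preimage_subset (T (α.1 m)) (closure_mono
      (show TT j α ⊆ (fun z : Fin n → M => z m) ⁻¹' T (α.1 m) from fun w hw => hw m) hz)
  have hN := fun j => sep_family (TT j) (hsepT j)
  choose NN hNo hNT hNd using hN
  let G : (Fin n → X) → (Fin n → M) := fun u m => F (u m)
  have hG : Continuous G := continuous_pi (fun m => hF.comp (continuous_apply m))
  let V : ∀ j, ι j → Set (Fin n → X) := fun j α => (G ⁻¹' NN j α) ∩ ⋂ m, (fun u => u m) ⁻¹' (C (α.1 m))
  have hVo : ∀ j α, IsOpen (V j α) := fun j α => ((hNo j α).preimage hG).inter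
    (isOpen_iInter_of_finite (fun m => (hC _).preimage (continuous_apply m)))
  refine ⟨fun j => ⋃ α, V j α, fun j => isOpen_iUnion (hVo j), ?_, fun j => ?_⟩
  · rw [Set.iUnion_eq_univ_iff]
    intro u
    choose α hα using fun m => hT (u m)
    have hsum : ∑ m, ρ (α m) < n * N + 1 := by
      have : ∑ m, ρ (α m) ≤ ∑ _m : Fin n, N := Finset.sum_le_sum (fun m _ => hρ _)
      simp at this
      omega
    refine ⟨⟨_, hsum⟩, Set.mem_iUnion.2 ⟨⟨α, rfl⟩, hNT _ _ hα, Set.mem_iInter.2 (fun m => ?_)⟩⟩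
    exact hTC _ _ (hα m)
  · refine sec_glue (tcPi X n) (V j) (hVo j) ?_ ?_
    · intro α β hαβ
      exact ((hNd j α β hαβ).preimage G).mono Set.inter_subset_left Set.inter_subset_left
    · intro α
      refine sec_of_contr hn (V j α) x0 (fun m => ?_)
      obtain ⟨h, hc, h0, h1⟩ := hcontr (α.1 m)
      refine ⟨fun q => h (⟨q.1.1 m, Set.mem_iInter.1 q.1.2.2 m⟩, q.2), hc.comp ?_, ?_, ?_⟩
      · refine Continuous.prodMk (Continuous.subtype_mk ?_ _) continuous_snd
        exact (continuous_apply m).comp (continuous_subtype_val.comp continuous_fst)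
      · intro u; exact h0 _
      · intro u; exact h1 _

end upper

end

end MilnorBU

namespace MilnorBU

noncomputable section

set_option linter.unusedSectionVars false

section upper2

variable {K : Type} [RCLike K] {E : Bool → ℕ}

theorem PM_diag_ne {d : ℕ} (p : Projectivization K (Fin d → K)) (a : Fin d) :
    PM p a a ≠ 0 ↔ p.rep a ≠ 0 := by
  unfold PM
  have := ip_self_ne p.rep_nonzero
  simp [this]

/-- normalised affine coordinates -/
def aff {d : ℕ} (p : Projectivization K (Fin d → K)) (a : Fin d) : Fin d → K :=
  fun k => PM p k a / PM p a a

theorem aff_self {d : ℕ} (p : Projectivization K (Fin d → K)) (a : Fin d) (h : PM p a a ≠ 0) :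
    aff p a a = 1 := div_self h

theorem mk_aff {d : ℕ} (p : Projectivization K (Fin d → K)) (a : Fin d) (h : PM p a a ≠ 0)
    (h' : aff p a ≠ 0) : Projectivization.mk K (aff p a) h' = p := by
  have e : aff p a = (p.rep a)⁻¹ • p.rep := by
    have h1 := (PM_diag_ne p a).1 h
    have h2 := ip_self_ne p.rep_nonzero
    have h3 : starRingEnd K (p.rep a) ≠ 0 := by simpa using h1
    funext k
    simp only [aff, PM, Pi.smul_apply, smul_eq_mul]
    field_simp
  conv_rhs => rw [← p.mk_rep]
  rw [Projectivization.mk_eq_mk_iff']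
  exact ⟨_, e.symm⟩

theorem aff_cont {d : ℕ} {T : Type*} [TopologicalSpace T] {f : T → Projectivization K (Fin d → K)}
    (hf : Continuous f) (a : Fin d) (h : ∀ t, PM (f t) a a ≠ 0) :
    Continuous fun t => aff (f t) a := by
  refine continuous_pi (fun k => ?_)
  exact ((continuous_PM k a).comp hf).div ((continuous_PM a a).comp hf) h

/-- points of the Milnor manifold -/
def pt (hE : E false ≤ E true) (x : Fin (E true + 1) → K) (y : Fin (E false + 1) → K)
    (hx : x ≠ 0) (hy : y ≠ 0) (h : ip (ex y) x = 0) : Mil K E :=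
  ⟨(Projectivization.mk K x hx, Projectivization.mk K y hy), (mem_Mil hE x y hx hy).2 h⟩

theorem pt_cont (hE : E false ≤ E true) {T : Type*} [TopologicalSpace T]
    {x : T → Fin (E true + 1) → K} {y : T → Fin (E false + 1) → K}
    (hx : ∀ t, x t ≠ 0) (hy : ∀ t, y t ≠ 0) (h : ∀ t, ip (ex (y t)) (x t) = 0)
    (hxc : Continuous x) (hyc : Continuous y) :
    Continuous fun t => pt hE (x t) (y t) (hx t) (hy t) (h t) := by
  refine Continuous.subtype_mk (Continuous.prodMk ?_ ?_) _
  · exact continuous_mk.comp (hxc.subtype_mk hx)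
  · exact continuous_mk.comp (hyc.subtype_mk hy)

def Cht (i : Fin (E false + 1)) (j : Fin (E true + 1)) : Set (Mil K E) :=
  {p | PM p.1.2 i i ≠ 0 ∧ PM p.1.1 j j ≠ 0}

theorem Cht_open (i : Fin (E false + 1)) (j : Fin (E true + 1)) : IsOpen (Cht i j : Set (Mil K E)) := by
  have h1 : Continuous fun p : Mil K E => PM p.1.2 i i :=
    (continuous_PM i i).comp (pr_cont false)
  have h2 : Continuous fun p : Mil K E => PM p.1.1 j j :=
    (continuous_PM j j).comp (pr_cont true)
  exact (isOpen_ne.preimage h1).inter (isOpen_ne.preimage h2)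

def ee (d : ℕ) (a : Fin d) : Fin d → K := fun k => if k = a then 1 else 0

theorem ee_ne (d : ℕ) (a : Fin d) : (ee d a : Fin d → K) ≠ 0 := by
  intro h
  simpa [ee] using congrFun h a

theorem ip_ee {d : ℕ} (v : Fin d → K) (a : Fin d) : ip v (ee d a) = starRingEnd K (v a) := by
  simp [ip, ee]

theorem ip_add_right {d : ℕ} (v w w' : Fin d → K) : ip v (w + w') = ip v w + ip v w' := by
  simp [ip, mul_add, Finset.sum_add_distrib]

theorem ne_of_apply {d : ℕ} {v : Fin d → K} {a : Fin d} (h : v a = 1) : v ≠ 0 := by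
  intro h0
  rw [h0] at h
  simp at h

theorem ex_at (hE : E false ≤ E true) (y : Fin (E false + 1) → K) (i : Fin (E false + 1)) :
    (ex y : Fin (E true + 1) → K) (Fin.castLE (by omega) i) = y i := by
  unfold ex
  rw [dif_pos (by exact i.2)]
  rfl

theorem ex_ee (hE : E false ≤ E true) (i : Fin (E false + 1)) :
    (ex (ee _ i : Fin (E false + 1) → K) : Fin (E true + 1) → K)
      = ee _ (Fin.castLE (by omega) i) := by
  funext a
  simp only [ex, ee, Fin.ext_iff, Fin.val_castLE]
  split_ifs with h1 h2 h3
  · rfl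
  · rfl
  · exact absurd i.2 (by omega)
  · rfl

theorem ip_ee_ee (hE : E false ≤ E true) (i : Fin (E false + 1)) (j : Fin (E true + 1))
    (h : (i : ℕ) ≠ j) :
    ip (ex (ee _ i : Fin (E false + 1) → K)) (ee (E true + 1) j) = 0 := by
  rw [ip_ee, ex_ee hE, ee, if_neg]
  · simp
  · intro h'
    exact h (by rw [h']; rfl)

def bpt (hE : E false ≤ E true) (i : Fin (E false + 1)) (j : Fin (E true + 1))
    (h : (i : ℕ) ≠ j) : Mil K E :=
  pt hE (ee _ j) (ee _ i) (ee_ne _ _) (ee_ne _ _) (ip_ee_ee hE i j h)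

/-- contraction of a chart -/
theorem chart_contr (hE : E false ≤ E true) (i : Fin (E false + 1)) (j : Fin (E true + 1))
    (hij : (i : ℕ) ≠ j) :
    ContinuousMap.Homotopic (⟨Subtype.val, continuous_subtype_val⟩ : C((Cht i j : Set (Mil K E)), Mil K E))
      (ContinuousMap.const _ (bpt hE i j hij)) := by
  let y : I × (Cht i j : Set (Mil K E)) → Fin (E false + 1) → K := fun q =>
    ((1 - (q.1 : ℝ) : ℝ) : K) • aff q.2.1.1.2 i + ((q.1 : ℝ) : K) • ee _ i
  let v : I × (Cht i j : Set (Mil K E)) → Fin (E true + 1) → K := fun q =>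
    ((1 - (q.1 : ℝ) : ℝ) : K) • aff q.2.1.1.1 j + ((q.1 : ℝ) : K) • ee _ j
  let i' : Fin (E true + 1) := Fin.castLE (by omega) i
  let x : I × (Cht i j : Set (Mil K E)) → Fin (E true + 1) → K := fun q => v q - ip (ex (y q)) (v q) • ee _ i'
  have hyi : ∀ q, y q i = 1 := by
    intro q
    simp only [y, ee, Pi.add_apply, Pi.smul_apply, smul_eq_mul, aff_self _ _ q.2.2.1, if_true]
    push_cast
    ring
  have hvj : ∀ q, v q j = 1 := by
    intro q
    simp only [v, ee, Pi.add_apply, Pi.smul_apply, smul_eq_mul, aff_self _ _ q.2.2.2, if_true]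
    push_cast
    ring
  have hxj : ∀ q, x q j = 1 := by
    intro q
    have : j ≠ i' := by
      intro h
      exact hij (by rw [h]; rfl)
    simp [x, hvj, ee, this]
  have hort : ∀ q, ip (ex (y q)) (x q) = 0 := by
    intro q
    have : (ex (y q) : Fin (E true + 1) → K) i' = 1 := by
      rw [ex_at hE, hyi]
    simp only [x]
    rw [ip_sub_right, ip_smul_right, ip_ee, this]
    simp
  have hts : Continuous fun q : I × (Cht i j : Set (Mil K E)) => ((1 - (q.1 : ℝ) : ℝ) : K) :=
    RCLike.continuous_ofReal.comp (by fun_prop)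
  have ht : Continuous fun q : I × (Cht i j : Set (Mil K E)) => ((q.1 : ℝ) : K) :=
    RCLike.continuous_ofReal.comp (by fun_prop)
  have hp : Continuous fun q : I × (Cht i j : Set (Mil K E)) => q.2.1 := continuous_subtype_val.comp continuous_snd
  have hyc : Continuous y := (hts.smul (aff_cont (f := fun q : I × (Cht i j : Set (Mil K E)) => q.2.1.1.2)
    ((pr_cont false).comp hp) i (fun q => q.2.2.1))).add (ht.smul continuous_const)
  have hvc : Continuous v := (hts.smul (aff_cont (f := fun q : I × (Cht i j : Set (Mil K E)) => q.2.1.1.1)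
    ((pr_cont true).comp hp) j (fun q => q.2.2.2))).add (ht.smul continuous_const)
  have hxc : Continuous x := hvc.sub ((continuous_ip (ex_cont.comp hyc) hvc).smul continuous_const)
  have hx0 : ∀ q, x q ≠ 0 := fun q => ne_of_apply (hxj q)
  have hy0 : ∀ q, y q ≠ 0 := fun q => ne_of_apply (hyi q)
  have hcont := pt_cont hE hx0 hy0 hort hxc hyc
  refine ⟨⟨⟨fun q => pt hE (x q) (y q) (hx0 q) (hy0 q) (hort q), hcont⟩, ?_, ?_⟩⟩
  · intro p
    have ey : y (0, p) = aff p.1.1.2 i := by simp [y]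
    have ev : v (0, p) = aff p.1.1.1 j := by simp [v]
    have n1 : aff p.1.1.2 i ≠ 0 := ne_of_apply (aff_self _ _ p.2.1)
    have n2 : aff p.1.1.1 j ≠ 0 := ne_of_apply (aff_self _ _ p.2.2)
    have m1 := mk_aff p.1.1.2 i p.2.1 n1
    have m2 := mk_aff p.1.1.1 j p.2.2 n2
    have hmem := p.1.2
    have hz : ip (ex (aff p.1.1.2 i)) (aff p.1.1.1 j) = 0 := by
      rw [← mem_Mil hE _ _ n2 n1, m1, m2]
      exact hmem
    have exx : x (0, p) = aff p.1.1.1 j := by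
      simp only [x, ey, ev, hz, zero_smul, sub_zero]
    apply Subtype.ext
    apply Prod.ext
    · change Projectivization.mk K (x (0, p)) _ = _
      simp only [exx]
      exact m2
    · change Projectivization.mk K (y (0, p)) _ = _
      simp only [ey]
      exact m1
  · intro p
    have ey : y (1, p) = ee _ i := by simp [y]
    have ev : v (1, p) = ee _ j := by simp [v]
    have exx : x (1, p) = ee _ j := by
      simp only [x, ey, ev]
      rw [ip_ee_ee hE i j hij, zero_smul, sub_zero]
    apply Subtype.ext
    apply Prod.ext
    · change Projectivization.mk K (x (1, p)) _ = Projectivization.mk K (ee _ j) _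
      simp only [exx]
    · change Projectivization.mk K (y (1, p)) _ = Projectivization.mk K (ee _ i) _
      simp only [ey]

theorem join_j (hE : E false ≤ E true) (i : Fin (E false + 1)) (j j' : Fin (E true + 1))
    (h : (i : ℕ) ≠ j) (h' : (i : ℕ) ≠ j') :
    Joined (bpt hE i j h : Mil K E) (bpt hE i j' h') := by
  by_cases hjj : j = j'
  · subst hjj; exact Joined.refl _
  let x : I → Fin (E true + 1) → K := fun t => ((1 - (t : ℝ) : ℝ) : K) • ee _ j + ((t : ℝ) : K) • ee _ j'
  have hxc : Continuous x := by
    have hts : Continuous fun q : I => ((1 - (q : ℝ) : ℝ) : K) :=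
      RCLike.continuous_ofReal.comp (by fun_prop)
    have ht : Continuous fun q : I => ((q : ℝ) : K) :=
      RCLike.continuous_ofReal.comp (by fun_prop)
    exact (hts.smul continuous_const).add (ht.smul continuous_const)
  have hx0 : ∀ t, x t ≠ 0 := by
    intro t ht
    have a := congrFun ht j
    have b := congrFun ht j'
    simp [x, ee, hjj, Ne.symm hjj] at a b
    rw [b] at a
    simp at a
  have hort : ∀ t, ip (ex (ee _ i : Fin (E false + 1) → K)) (x t) = 0 := by
    intro t
    simp only [x]
    rw [ip_add_right, ip_smul_right, ip_smul_right, ip_ee_ee hE i j h, ip_ee_ee hE i j' h']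
    simp
  refine ⟨⟨⟨fun t => pt hE (x t) (ee _ i) (hx0 t) (ee_ne _ _) (hort t),
    pt_cont hE hx0 (fun _ => ee_ne _ _) hort hxc continuous_const⟩, ?_, ?_⟩⟩
  · have : x 0 = ee _ j := by simp [x]
    simp only [this]; rfl
  · have : x 1 = ee _ j' := by simp [x]
    simp only [this]; rfl

theorem ex_add (y y' : Fin (E false + 1) → K) :
    (ex (y + y') : Fin (E true + 1) → K) = ex y + ex y' := by
  funext i
  simp only [ex, Pi.add_apply]
  split_ifs <;> simp

theorem ip_add_left {d : ℕ} (v v' w : Fin d → K) : ip (v + v') w = ip v w + ip v' w := by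
  simp [ip, add_mul, Finset.sum_add_distrib]

theorem join_i (hE : E false ≤ E true) (i i' : Fin (E false + 1)) (j : Fin (E true + 1))
    (h : (i : ℕ) ≠ j) (h' : (i' : ℕ) ≠ j) :
    Joined (bpt hE i j h : Mil K E) (bpt hE i' j h') := by
  by_cases hjj : i = i'
  · subst hjj; exact Joined.refl _
  let y : I → Fin (E false + 1) → K := fun t => ((1 - (t : ℝ) : ℝ) : K) • ee _ i + ((t : ℝ) : K) • ee _ i'
  have hyc : Continuous y := by
    have hts : Continuous fun q : I => ((1 - (q : ℝ) : ℝ) : K) :=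
      RCLike.continuous_ofReal.comp (by fun_prop)
    have ht : Continuous fun q : I => ((q : ℝ) : K) :=
      RCLike.continuous_ofReal.comp (by fun_prop)
    exact (hts.smul continuous_const).add (ht.smul continuous_const)
  have hy0 : ∀ t, y t ≠ 0 := by
    intro t ht
    have a := congrFun ht i
    have b := congrFun ht i'
    simp [y, ee, hjj, Ne.symm hjj] at a b
    rw [b] at a
    simp at a
  have hort : ∀ t, ip (ex (y t)) (ee (E true + 1) j : Fin (E true + 1) → K) = 0 := by
    intro t
    simp only [y]
    rw [ex_add, ex_smul, ex_smul, ip_add_left, ip_smul_left, ip_smul_left, ip_ee_ee hE i j h,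
      ip_ee_ee hE i' j h']
    simp
  refine ⟨⟨⟨fun t => pt hE (ee _ j) (y t) (ee_ne _ _) (hy0 t) (hort t),
    pt_cont hE (fun _ => ee_ne _ _) hy0 hort continuous_const hyc⟩, ?_, ?_⟩⟩
  · have : y 0 = ee _ i := by simp [y]
    simp only [this]; rfl
  · have : y 1 = ee _ i' := by simp [y]
    simp only [this]; rfl

theorem join_all (hE : E false ≤ E true) (hs : 2 ≤ E false) (i : Fin (E false + 1))
    (j : Fin (E true + 1)) (h : (i : ℕ) ≠ j) :
    Joined (bpt hE i j h : Mil K E) (bpt hE 0 (Fin.last _) (by simp; omega)) := by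
  by_cases hi : (i : ℕ) = E true
  · have a1 : (i : ℕ) ≠ (⟨1, by omega⟩ : Fin (E true + 1)) := by simp; omega
    have a2 : ((0 : Fin (E false + 1)) : ℕ) ≠ (⟨1, by omega⟩ : Fin (E true + 1)) := by simp
    exact ((join_j hE i j ⟨1, by omega⟩ h a1).trans (join_i hE i 0 ⟨1, by omega⟩ a1 a2)).trans
      (join_j hE 0 ⟨1, by omega⟩ (Fin.last _) a2 _)
  · have a1 : (i : ℕ) ≠ Fin.last (E true) := by simpa using hi
    exact (join_j hE i j _ h a1).trans (join_i hE i 0 _ a1 _)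

theorem chart_contr' (hE : E false ≤ E true) (hs : 2 ≤ E false) (i : Fin (E false + 1))
    (j : Fin (E true + 1)) (hij : (i : ℕ) ≠ j) :
    ∃ h : ↥(Cht i j : Set (Mil K E)) × ℝ → Mil K E, Continuous h ∧ (∀ u, h (u, 0) = u) ∧
      ∀ u, h (u, 1) = bpt hE 0 (Fin.last _) (by simp; omega) := by
  obtain ⟨γ⟩ := join_all (K := K) hE hs i j hij
  have h2 : ContinuousMap.Homotopic (ContinuousMap.const (Cht i j : Set (Mil K E)) (bpt hE i j hij : Mil K E))
      (ContinuousMap.const _ (bpt hE 0 (Fin.last _) (by simp; omega))) :=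
    ⟨⟨⟨fun q => γ q.1, γ.continuous.comp continuous_fst⟩, fun _ => γ.source, fun _ => γ.target⟩⟩
  obtain ⟨H⟩ := (chart_contr hE i j hij).trans h2
  refine ⟨fun q => H (Set.projIcc (0 : ℝ) 1 zero_le_one q.2, q.1), H.continuous.comp
    (Continuous.prodMk (continuous_projIcc.comp continuous_snd) continuous_fst), ?_, ?_⟩
  · intro u
    have : Set.projIcc (0 : ℝ) 1 zero_le_one 0 = 0 := Set.projIcc_left _
    simp only [this]
    exact H.apply_zero u
  · intro u
    have : Set.projIcc (0 : ℝ) 1 zero_le_one 1 = 1 := Set.projIcc_right _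
    simp only [this]
    exact H.apply_one u

/-- rank of a stratum -/
def rk (s i j : ℕ) : ℕ := (s - i) + (if i < j then j - 1 else j)

theorem upper (hE : E false ≤ E true) (hs : 2 ≤ E false) (n : ℕ) (hn : 2 ≤ n) :
    ∃ U : Fin (n * (E false + E true - 1) + 1) → Set (Fin n → Mil K E),
    (∀ i, IsOpen (U i)) ∧ (⋃ i, U i) = Set.univ ∧
    ∀ i, ∃ sec : C(U i, C(I, Mil K E)), ∀ u : U i, tcPi (Mil K E) n (sec u) = (u : Fin n → Mil K E) := by
  classical
  let P : Type := {q : Fin (E false + 1) × Fin (E true + 1) // (q.1 : ℕ) ≠ q.2}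
  let F : Mil K E → (Fin (E false + 1) → K) × (Fin (E true + 1) → K) := fun p =>
    (fun k => PM p.1.2 k k, fun k => PM p.1.1 k k)
  let T : P → Set ((Fin (E false + 1) → K) × (Fin (E true + 1) → K)) := fun q =>
    {z | ((∀ k, k < q.1.1 → z.1 k = 0) ∧ ∀ k, q.1.2 < k → z.2 k = 0) ∧ z.1 q.1.1 ≠ 0 ∧ z.2 q.1.2 ≠ 0}
  have hT' : ∀ q, closure (T q) ⊆ {z | (∀ k, k < q.1.1 → z.1 k = 0) ∧ ∀ k, q.1.2 < k → z.2 k = 0} := by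
    intro q
    refine closure_minimal (fun z hz => hz.1) ?_
    have e : {z : (Fin (E false + 1) → K) × (Fin (E true + 1) → K) |
        (∀ k, k < q.1.1 → z.1 k = 0) ∧ ∀ k, q.1.2 < k → z.2 k = 0}
        = (⋂ k, ⋂ (_ : k < q.1.1), {z | z.1 k = 0}) ∩ (⋂ k, ⋂ (_ : q.1.2 < k), {z | z.2 k = 0}) := by
      ext z
      simp
    rw [e]
    refine IsClosed.inter (isClosed_iInter fun k => isClosed_iInter fun _ => isClosed_eq ?_ continuous_const)
      (isClosed_iInter fun k => isClosed_iInter fun _ => isClosed_eq ?_ continuous_const)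
    · exact (continuous_apply k).comp continuous_fst
    · exact (continuous_apply k).comp continuous_snd
  refine strat_upper (P := P) F ?_ T (fun q => rk (E false) q.1.1 q.1.2) _ ?_ ?_ ?_
    (fun q => Cht q.1.1 q.1.2) (fun q => Cht_open _ _) ?_ (bpt hE 0 (Fin.last _) (by simp; omega))
    (fun q => chart_contr' hE hs _ _ q.2) n hn
  · refine Continuous.prodMk (continuous_pi fun k => ?_) (continuous_pi fun k => ?_)
    · exact (continuous_PM k k).comp (pr_cont false)
    · exact (continuous_PM k k).comp (pr_cont true)
  · rintro ⟨⟨i, j⟩, hij⟩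
    have := i.2
    have := j.2
    simp only [rk]
    split_ifs <;> omega
  · intro p
    have hy : ∃ k, p.1.2.rep k ≠ 0 := Function.ne_iff.1 p.1.2.rep_nonzero
    have hx : ∃ k, p.1.1.rep k ≠ 0 := Function.ne_iff.1 p.1.1.rep_nonzero
    let A : Finset (Fin (E false + 1)) := Finset.univ.filter fun k => p.1.2.rep k ≠ 0
    let B : Finset (Fin (E true + 1)) := Finset.univ.filter fun k => p.1.1.rep k ≠ 0
    have hA : A.Nonempty := by
      obtain ⟨k, hk⟩ := hy
      exact ⟨k, by simpa [A] using hk⟩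
    have hB : B.Nonempty := by
      obtain ⟨k, hk⟩ := hx
      exact ⟨k, by simpa [B] using hk⟩
    have i1 : p.1.2.rep (A.min' hA) ≠ 0 := by
      simpa [A] using A.min'_mem hA
    have j1 : p.1.1.rep (B.max' hB) ≠ 0 := by
      simpa [B] using B.max'_mem hB
    have i2 : ∀ k, k < A.min' hA → p.1.2.rep k = 0 := by
      intro k hk
      by_contra h
      exact absurd (A.min'_le k (by simpa [A] using h)) (not_le.2 hk)
    have j2 : ∀ k, B.max' hB < k → p.1.1.rep k = 0 := by
      intro k hk
      by_contra h
      exact absurd (B.le_max' k (by simpa [B] using h)) (not_le.2 hk)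
    generalize A.min' hA = i at *
    generalize B.max' hB = j at *
    have hij : (i : ℕ) ≠ j := by
      intro hij
      have hm : ip (ex p.1.2.rep) p.1.1.rep = 0 := by
        rw [← sum_eq_ip hE]
        exact p.2
      have e : ip (ex p.1.2.rep) p.1.1.rep
          = starRingEnd K ((ex p.1.2.rep : Fin (E true + 1) → K) j) * p.1.1.rep j := by
        unfold ip
        refine Finset.sum_eq_single j (fun k _ hk => ?_) (by simp)
        rcases lt_or_gt_of_ne hk with h | h
        · have hk' : (k : ℕ) < j := h
          have : (ex p.1.2.rep : Fin (E true + 1) → K) k = 0 := by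
            unfold ex
            split_ifs with h1
            · exact i2 _ (by rw [Fin.lt_def]; simp only; omega)
            · rfl
          rw [this]; simp
        · rw [j2 k h]; simp
      rw [e] at hm
      have hj : j = Fin.castLE (by omega) i := Fin.ext hij.symm
      have h3 : (ex p.1.2.rep : Fin (E true + 1) → K) j = p.1.2.rep i := by
        rw [hj, ex_at hE]
      rw [h3] at hm
      rcases mul_eq_zero.1 hm with h | h
      · exact i1 (by simpa using h)
      · exact j1 h
    have z : ∀ {d : ℕ} (p : Projectivization K (Fin d → K)) (a : Fin d), p.rep a = 0 → PM p a a = 0 := by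
      intro d p a h
      simp [PM, h]
    exact ⟨⟨(i, j), hij⟩, ⟨fun k hk => z _ _ (i2 k hk), fun k hk => z _ _ (j2 k hk)⟩,
      (PM_diag_ne _ _).2 i1, (PM_diag_ne _ _).2 j1⟩
  · intro q q' hne hr
    rw [Set.disjoint_left]
    intro z hz hz'
    have hz := hT' q hz
    have a1 : q.1.1 ≤ q'.1.1 := by
      by_contra h
      exact hz'.2.1 (hz.1 _ (not_le.1 h))
    have a2 : q'.1.2 ≤ q.1.2 := by
      by_contra h
      exact hz'.2.2 (hz.2 _ (not_le.1 h))
    apply hne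
    obtain ⟨⟨i, j⟩, hij⟩ := q
    obtain ⟨⟨i', j'⟩, hij'⟩ := q'
    simp only [Fin.le_def] at a1 a2
    simp only [rk] at hr
    simp only at hij hij'
    have := i.2
    have := i'.2
    have : (i : ℕ) = i' ∧ (j : ℕ) = j' := by
      split_ifs at hr <;> omega
    apply Subtype.ext
    exact Prod.ext (Fin.ext this.1) (Fin.ext this.2)
  · intro q p hp
    exact hp.2

end upper2

end

end MilnorBU

namespace MilnorBU

noncomputable section

set_option linter.unusedSectionVars false

section final

variable {K : Type} [RCLike K] {E : Bool → ℕ}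

theorem both (hBU : BUProp K) (hE : E false ≤ E true) (c : Bool) (p q : ℕ)
    (hs : 2 ≤ E false)
    (h1 : E c = 2 ^ p) (h2 : E (!c) = 2 ^ q + 1) (n : ℕ) (hn : 2 ≤ n) :
    n * (E false + E true - 1) - 1 ≤ higherTC (↥(Mil K E)) n ∧
      higherTC (↥(Mil K E)) n ≤ n * (E false + E true - 1) + 1 := by
  have hup := upper (K := K) hE hs n hn
  have hle : higherTC (↥(Mil K E)) n ≤ n * (E false + E true - 1) + 1 :=
    Nat.sInf_le ⟨Nat.succ_pos _, hup⟩
  refine ⟨?_, hle⟩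
  obtain ⟨k, rfl⟩ : ∃ k, n = k + 2 := ⟨n - 2, by omega⟩
  by_contra hlt
  push Not at hlt
  have hmem := Nat.sInf_mem (s := {k' | 0 < k' ∧ ∃ U : Fin k' → Set (Fin (k + 2) → Mil K E),
    (∀ i, IsOpen (U i)) ∧ (⋃ i, U i) = Set.univ ∧
    ∀ i, ∃ sec : C(U i, C(I, Mil K E)), ∀ u : U i,
      tcPi (Mil K E) (k + 2) (sec u) = (u : Fin (k + 2) → Mil K E)})
    ⟨_, Nat.succ_pos _, hup⟩
  obtain ⟨-, U, hUo, hcov, hsec⟩ := hmem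
  have hcard := card_ZZ k c E (by omega) hs
  refine lower (k := k) hBU hE c (coeff_main k p q c E h1 h2) _ ?_ U hUo hcov hsec
  change higherTC (↥(Mil K E)) (k + 2) ≤ _
  omega

theorem real_eq (r s : ℕ) : RealMilnor r s = Mil ℝ (fun b => bif b then r else s) := by
  ext p
  unfold RealMilnor Mil
  simp only [Set.mem_ofPred_eq, conj_trivial]
  rfl

theorem complex_eq (r s : ℕ) : ComplexMilnor r s = Mil ℂ (fun b => bif b then r else s) := rfl

end final

end

end MilnorBU

/-- For `0 ≤ s ≤ r` with `s = 2^{t₁}+1, r = 2^{t₂}` or `s = 2^{p₁},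
r = 2^{p₂}+1` (for positive exponents), `F ∈ {ℝ, ℂ}` and `n ≥ 2`:
`n(s+r-1) - 1 ≤ TC_n(FH_{r,s}) ≤ n(s+r-1) + 1`. -/
theorem higherTC_milnor_sharp_bounds (r s n : ℕ) (hsr : s ≤ r) (hn : 2 ≤ n)
    (hcase : (∃ t₁ t₂ : ℕ, 0 < t₁ ∧ 0 < t₂ ∧ s = 2 ^ t₁ + 1 ∧ r = 2 ^ t₂) ∨
      (∃ p₁ p₂ : ℕ, 0 < p₁ ∧ 0 < p₂ ∧ s = 2 ^ p₁ ∧ r = 2 ^ p₂ + 1)) :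
    (n * (s + r - 1) - 1 ≤ higherTC (↥(RealMilnor r s)) n ∧
      higherTC (↥(RealMilnor r s)) n ≤ n * (s + r - 1) + 1) ∧
    (n * (s + r - 1) - 1 ≤ higherTC (↥(ComplexMilnor r s)) n ∧
      higherTC (↥(ComplexMilnor r s)) n ≤ n * (s + r - 1) + 1) := by
  have hpow : ∀ t : ℕ, 0 < t → 2 ≤ 2 ^ t := fun t ht => by
    calc 2 = 2 ^ 1 := rfl
      _ ≤ 2 ^ t := Nat.pow_le_pow_right (by norm_num) ht
  have hs : 2 ≤ s := by
    rcases hcase with ⟨t₁, t₂, a, b, c, d⟩ | ⟨t₁, t₂, a, b, c, d⟩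
    · have := hpow t₁ a
      omega
    · have := hpow t₁ a
      omega
  have hcq : ∃ (c : Bool) (p q : ℕ), (fun b : Bool => bif b then r else s) c = 2 ^ p ∧
      (fun b : Bool => bif b then r else s) (!c) = 2 ^ q + 1 := by
    rcases hcase with ⟨t₁, t₂, _, _, c, d⟩ | ⟨t₁, t₂, _, _, c, d⟩
    · exact ⟨true, t₂, t₁, d, c⟩
    · exact ⟨false, t₁, t₂, c, d⟩
  obtain ⟨c, p, q, h1, h2⟩ := hcq
  rw [MilnorBU.real_eq, MilnorBU.complex_eq]
  exact ⟨MilnorBU.both (E := fun b => bif b then r else s) MilnorBU.BUProp_real hsr c p q hs h1 h2 n hn,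
    MilnorBU.both (E := fun b => bif b then r else s) MilnorBU.BUProp_complex hsr c p q hs h1 h2 n hn⟩
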